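/- arXiv:0806.0424 — 9 statements merged into one kernel-verified Lean document; each statement's English description precedes it below -/
import Mathlib

section
/- For all integers n ≥ 0 and k ≥ 0, the number p_{n,n+k;≤n+k} of parking functions of length n with n+k parking spaces satisfies p_{n,n+k;≤n+k} = Σ_{r_0+r_1+⋯+r_k = n} [n!/(r_0!·r_1!⋯r_k!)] · ∏_{i=0}^{k} (r_i+1)^{r_i−1}, where the sum is over all (k+1)-tuples (r_0,…,r_k) of nonnegative integers summing to n. -/
/-- A parking function of length `n`: a sequence of positive integers whose
nondecreasing rearrangement `b` satisfies `b i ≤ i` (1-indexed). -/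
def IsParkingFunction (n : ℕ) (a : Fin n → ℕ) : Prop :=
  (∀ i, 1 ≤ a i) ∧
  ∃ σ : Equiv.Perm (Fin n), Monotone (a ∘ σ) ∧ ∀ i : Fin n, a (σ i) ≤ (i : ℕ) + 1

/-- A parking function of length `n` with `m ≥ n` parking spaces: entries in `[1,m]`
whose nondecreasing rearrangement `b` satisfies `b i ≤ m - n + i` (1-indexed). -/
def IsParkingFunctionWith (n m : ℕ) (a : Fin n → ℕ) : Prop :=
  (∀ i, 1 ≤ a i ∧ a i ≤ m) ∧
  ∃ σ : Equiv.Perm (Fin n), Monotone (a ∘ σ) ∧ ∀ i : Fin n, a (σ i) ≤ m - n + ((i : ℕ) + 1)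

/-- `pN n` = number of parking functions of length `n` (so `pN n = (n+1)^(n-1)`). -/
noncomputable def pN (n : ℕ) : ℕ := Nat.card {a : Fin n → ℕ // IsParkingFunction n a}

/-- `pWith n m` = `p_{n,m;≤m}`, the number of parking functions of length `n`
with `m` parking spaces. -/
noncomputable def pWith (n m : ℕ) : ℕ := Nat.card {a : Fin n → ℕ // IsParkingFunctionWith n m a}

/-- `pLe n s` = `p_{n;≤s}`, the number of parking functions of length `n`
all of whose entries are at most `s`. -/
noncomputable def pLe (n s : ℕ) : ℕ :=
  Nat.card {a : Fin n → ℕ // IsParkingFunction n a ∧ ∀ i, a i ≤ s}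

/-- `pEq n s` = `p_{n;=s} = p_{n;≤s} - p_{n;≤s-1}` (with `p_{n;≤s} = 0` for `s < 0`). -/
noncomputable def pEq (n s : ℕ) : ℕ := pLe n s - (if s = 0 then 0 else pLe n (s - 1))

/-- `pLeL n s l` = `p_{n;≤s}^l`, the number of parking functions of length `n` with all
entries at most `s` and first entry equal to `l`. -/
noncomputable def pLeL (n s l : ℕ) : ℕ :=
  Nat.card {a : Fin n → ℕ //
    IsParkingFunction n a ∧ (∀ i, a i ≤ s) ∧ (List.ofFn a).head? = some l}

/-- `pL n l` = `p_n^l`, the number of parking functions of length `n` with first entry `l`. -/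
noncomputable def pL (n l : ℕ) : ℕ :=
  Nat.card {a : Fin n → ℕ //
    IsParkingFunction n a ∧ (List.ofFn a).head? = some l}

/-- `pEqL n s l` = `p_{n;=s}^l = p_{n;≤s}^l - p_{n;≤s-1}^l`. -/
noncomputable def pEqL (n s l : ℕ) : ℕ := pLeL n s l - (if s = 0 then 0 else pLeL n (s - 1) l)

/-- Simulate the parking process with `m` spaces: cars arrive in order with the given
preference list, each parks in the first free space among `pref, pref+1, …, m` if any;
returns the number of cars that leave unparked, given the set `occ` of occupied spaces. -/
def flawCount (m : ℕ) : List ℕ → Finset ℕ → ℕ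
  | [], _ => 0
  | p :: rest, occ =>
    match (List.range' p (m + 1 - p)).find? (fun s => decide (s ∉ occ)) with
    | some s => flawCount m rest (insert s occ)
    | none => flawCount m rest occ + 1

/-- `pFlaw n m k` = `p_{n,m;≤m;k}`, the number of `k`-flaw preference sets of length `n`
with `m` parking spaces and all entries in `[1,m]`. -/
noncomputable def pFlaw (n m k : ℕ) : ℕ :=
  Nat.card {a : Fin n → ℕ //
    (∀ i, 1 ≤ a i ∧ a i ≤ m) ∧ flawCount m (List.ofFn a) ∅ = k}

/-- `P(x) = Σ_{n≥0} (n+1)^(n-1) xⁿ/n!` in `ℚ[[x]]`. -/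
noncomputable def Pser : PowerSeries ℚ :=
  PowerSeries.mk fun n => ((n : ℚ) + 1) ^ (n - 1) / n.factorial

/-- `Q_k(x) = Σ_{n≥0} p_{n,n+k;≤n+k} xⁿ/n!` in `ℚ[[x]]`. -/
noncomputable def Qser (k : ℕ) : PowerSeries ℚ :=
  PowerSeries.mk fun n => (pWith n (n + k) : ℚ) / n.factorial

/-- `R_k(x) = Σ_{n≥k} p_{n;≤n-k} xⁿ/n!` in `ℚ[[x]]`. -/
noncomputable def Rser (k : ℕ) : PowerSeries ℚ :=
  PowerSeries.mk fun n => if n < k then 0 else (pLe n (n - k) : ℚ) / n.factorial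

/-- `H_k(x) = Σ_{n≥k} p_{n;=n-k} xⁿ/n!` in `ℚ[[x]]`. -/
noncomputable def Hser (k : ℕ) : PowerSeries ℚ :=
  PowerSeries.mk fun n => if n < k then 0 else (pEq n (n - k) : ℚ) / n.factorial

/-- `T_k(x) = Σ_{n≥k+1} p_n^{n-k} xⁿ/(n-1)!` in `ℚ[[x]]`. -/
noncomputable def Tser (k : ℕ) : PowerSeries ℚ :=
  PowerSeries.mk fun n => if n < k + 1 then 0 else (pL n (n - k) : ℚ) / (n - 1).factorial

/-- `F_{k,s}(x) = Σ_{n≥s+1} p_{n;≤n-k}^{n-s} xⁿ/(n-1)!` in `ℚ[[x]]`. -/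
noncomputable def Fser (k s : ℕ) : PowerSeries ℚ :=
  PowerSeries.mk fun n =>
    if n < s + 1 then 0 else (pLeL n (n - k) (n - s) : ℚ) / (n - 1).factorial
section Helpers
open Finset
noncomputable def uu (n c : ℕ) : ℚ := if n = 0 then 1 else c * ((c:ℚ)+n)^(n-1) / n.factorial

theorem binom_anti (X : ℚ) (n : ℕ) :
    ∑ p ∈ antidiagonal n, (1/(p.1.factorial:ℚ)) * (X^p.2 / p.2.factorial) = (X+1)^n / n.factorial := by
  rw [add_comm X 1, (Commute.one_left X).add_pow', Finset.sum_div]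
  refine Finset.sum_congr rfl fun p hp => ?_
  have hp' := mem_antidiagonal.1 hp
  subst hp'
  have h := Nat.add_choose_mul_factorial_mul_factorial p.1 p.2
  have h' : (((p.1+p.2).choose p.1 : ℕ):ℚ) * p.1.factorial * p.2.factorial = (p.1+p.2).factorial := by
    rw [Nat.choose_symm_add]; exact_mod_cast h
  have := Nat.factorial_ne_zero p.1
  have := Nat.factorial_ne_zero p.2
  have := Nat.factorial_ne_zero (p.1+p.2)
  rw [← h'] 
  rw [← h'] at *
  simp only [nsmul_eq_mul, one_pow, one_mul]
  have h3 : (((p.1+p.2).choose p.1 : ℕ):ℚ) ≠ 0 := by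
    have := (Nat.choose_pos (Nat.le_add_right p.1 p.2)).ne'
    exact_mod_cast this
  field_simp

theorem uu_rec (n c : ℕ) :
    uu n (c+1) = ∑ p ∈ antidiagonal n, (1/(p.1.factorial:ℚ)) * uu p.2 (c+p.1) := by
  rcases n with _ | n
  · simp [uu]
  set X : ℚ := c + (n+1) with hX
  have h1 := binom_anti X (n+1)
  have h2 := binom_anti X n
  rw [Finset.Nat.sum_antidiagonal_succ'] at h1 ⊢
  have h3 : ∑ p ∈ antidiagonal n, (1/(p.1.factorial:ℚ)) * uu (p.2+1) (c+p.1) = 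
     ∑ p ∈ antidiagonal n, (1/(p.1.factorial:ℚ)) * (X^(p.2+1) / (p.2+1).factorial)
     - ∑ p ∈ antidiagonal n, (1/(p.1.factorial:ℚ)) * (X^(p.2) / (p.2).factorial) := by
    rw [← Finset.sum_sub_distrib]
    refine Finset.sum_congr rfl fun p hp => ?_
    have hp' : (p.1:ℚ) + p.2 = n := by exact_mod_cast mem_antidiagonal.1 hp
    have e : ((c + p.1 : ℕ) : ℚ) + (p.2+1 : ℕ) = X := by
      push_cast; rw [hX, ← hp']; ring
    have e2 : ((c + p.1 : ℕ) : ℚ) = X - (p.2+1) := by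
      rw [← e]; push_cast; ring
    unfold uu
    rw [if_neg (by omega), e, e2, Nat.factorial_succ]
    simp only [Nat.add_sub_cancel]
    push_cast
    field_simp
    ring
  simp only at h1 h3 ⊢
  have e0 : uu 0 (c+(n+1)) = X^0 / (Nat.factorial 0) := by simp [uu]
  rw [h3, e0]
  have e1 : uu (n+1) (c+1) = (X+1)^(n+1) / (n+1).factorial - (X+1)^n / n.factorial := by
    unfold uu
    rw [if_neg (by omega), Nat.factorial_succ]
    simp only [Nat.add_sub_cancel]
    push_cast
    rw [show (c:ℚ)+1+(n+1) = X+1 by rw [hX]; ring, show (c:ℚ)+1 = X+1-(n+1) by rw [hX]; ring]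
    field_simp
    ring
  rw [e1, ← h1, ← h2]
  ring

theorem uu_zero (n : ℕ) : uu n 0 = if n = 0 then 1 else 0 := by
  simp [uu]

theorem uu_add (s : ℕ) : ∀ n c d, n + c = s →
    uu n (c+d) = ∑ p ∈ antidiagonal n, uu p.1 c * uu p.2 d := by
  induction s with
  | zero =>
    intro n c d h
    obtain rfl : n = 0 := by omega
    simp [uu]
  | succ s ih =>
    intro n c d h
    rcases c with _ | c
    · rcases n with _ | n
      · simp [uu]
      · rw [Finset.Nat.sum_antidiagonal_succ]
        simp [uu_zero]
        try simp [uu]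
    · have e : c + 1 + d = (c + d) + 1 := by ring
      rw [e, uu_rec]
      simp_rw [uu_rec _ c, Finset.sum_mul]
      have : ∀ p ∈ antidiagonal n, (1/(p.1.factorial:ℚ)) * uu p.2 (c+d+p.1) =
        ∑ q ∈ antidiagonal p.2, (1/(p.1.factorial:ℚ)) * (uu q.1 (c+p.1) * uu q.2 d) := by
        intro p hp
        have := mem_antidiagonal.1 hp
        rw [show c + d + p.1 = (c+p.1)+d by ring, ih p.2 (c+p.1) d (by omega), Finset.mul_sum]
      rw [Finset.sum_congr rfl this, Finset.sum_sigma', Finset.sum_sigma']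
      symm
      apply Finset.sum_nbij' (fun ⟨⟨i,j⟩,⟨k,l⟩⟩ => ⟨(k, l+j), (l,j)⟩) (fun ⟨⟨i,j⟩,⟨k,l⟩⟩ => ⟨(i+k,l),(i,k)⟩) <;> 
        simp +contextual [mul_assoc] <;> intros <;> (try grind)

theorem uu_tuple (k : ℕ) : ∀ n, ∑ r ∈ Finset.Nat.antidiagonalTuple k n, ∏ i, uu (r i) 1 = uu n k := by
  induction k with
  | zero => intro n; cases n <;> simp [uu]
  | succ k ih =>
    intro n
    rw [add_comm k 1, uu_add _ n 1 k rfl]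
    simp_rw [← ih, Finset.mul_sum]
    rw [Finset.sum_sigma', add_comm 1 k]
    apply Finset.sum_nbij' (fun r => ⟨(r 0, ∑ i, Fin.tail r i), Fin.tail r⟩)
      (fun x => (Fin.cons x.1.1 x.2 : Fin (k+1) → ℕ))
    · intro r hr
      simp [Finset.Nat.mem_antidiagonalTuple, Fin.sum_univ_succ, Fin.tail] at hr ⊢
      exact hr
    · rintro ⟨⟨i, j⟩, r⟩ hr
      simp [Finset.Nat.mem_antidiagonalTuple, Fin.sum_univ_succ] at hr ⊢
      omega
    · intro r hr
      simp
    · rintro ⟨⟨i, j⟩, r⟩ hr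
      simp [Finset.Nat.mem_antidiagonalTuple] at hr ⊢
      exact hr.2
    · intro r hr
      simp [Fin.prod_univ_succ, Fin.tail]

theorem rhs_eq (n k : ℕ) :
    ((∑ r ∈ Finset.Nat.antidiagonalTuple k n,
        Nat.multinomial Finset.univ r * ∏ i, (r i + 1) ^ (r i - 1) : ℕ) : ℚ)
      = n.factorial * uu n k := by
  rw [← uu_tuple, Finset.mul_sum]
  push_cast
  refine Finset.sum_congr rfl fun r hr => ?_
  have hs := Finset.Nat.mem_antidiagonalTuple.1 hr
  have h := Nat.multinomial_spec Finset.univ r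
  rw [hs] at h
  have h' : (∏ i, ((r i).factorial : ℚ)) * Nat.multinomial Finset.univ r = n.factorial := by
    exact_mod_cast h
  have e : ∀ i, uu (r i) 1 = ((r i : ℚ) + 1)^(r i - 1) / (r i).factorial := by
    intro i
    unfold uu
    split_ifs with h0
    · simp [h0]
    · simp [add_comm]
  simp_rw [e, Finset.prod_div_distrib]
  rw [← h']
  have : (∏ i, ((r i).factorial : ℚ)) ≠ 0 :=
    Finset.prod_ne_zero_iff.2 fun i _ => by exact_mod_cast Nat.factorial_ne_zero _
  field_simp

def PK {ι : Type} [Fintype ι] (c : ℕ) (a : ι → ℕ) : Prop :=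
  ∀ v < Fintype.card ι + c, v < c + #{i | a i < v}

theorem card_split {ι : Type} [Fintype ι] [DecidableEq ι] (a : ι → ℕ) (Z : Finset ι)
    (hZ : ∀ i, a i = 0 ↔ i ∈ Z) (w : ℕ) :
    #{i | a i < w + 1} = #Z + #{i : {i // i ∉ Z} | a i - 1 < w} := by
  have h1 : ({i | a i < w + 1} : Finset ι) = Z ∪
      (({i : {i // i ∉ Z} | a i - 1 < w} : Finset {i // i ∉ Z}).map (Function.Embedding.subtype _)) := by
    ext i
    have := hZ i
    by_cases hi : i ∈ Z
    · have h0 : a i = 0 := this.2 hi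
      simp [hi]; omega
    · have h0 : a i ≠ 0 := fun h => hi (this.1 h)
      simp [hi]; omega
  rw [h1, Finset.card_union_of_disjoint, Finset.card_map]
  rw [Finset.disjoint_left]
  intro i hi
  simp [hi]

theorem cardNot {ι : Type} [Fintype ι] [DecidableEq ι] (Z : Finset ι) :
    Fintype.card {i // i ∉ Z} + #Z = Fintype.card ι := by
  have h1 : Fintype.card {i // i ∉ Z} = #(Zᶜ) := Fintype.card_of_subtype _ (by simp)
  rw [h1]
  exact Finset.card_compl_add_card Z

theorem PK_split {ι : Type} [Fintype ι] [DecidableEq ι] (c : ℕ) (a : ι → ℕ) (Z : Finset ι)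
    (hZ : ∀ i, a i = 0 ↔ i ∈ Z) :
    PK (c+1) a ↔ PK (c + #Z) (fun i : {i // i ∉ Z} => a i - 1) := by
  have hc : Fintype.card {i // i ∉ Z} + #Z = Fintype.card ι := by
    exact cardNot Z
  unfold PK
  constructor
  · intro h w hw
    have := h (w+1) (by omega)
    rw [card_split a Z hZ] at this
    simp only
    omega
  · intro h v hv
    rcases v with _ | w
    · omega
    · rw [card_split a Z hZ]
      have := h w (by omega)
      simp only at this
      omega

noncomputable def fibEquiv {ι : Type} [Fintype ι] [DecidableEq ι] (c : ℕ) (Z : Finset ι) :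
    {x : {a : ι → ℕ // PK (c+1) a} // ({i | x.1 i = 0} : Finset ι) = Z} ≃
      {b : {i // i ∉ Z} → ℕ // PK (c + #Z) b} where
  toFun x := ⟨fun i => x.1.1 i - 1, (PK_split c x.1.1 Z (fun i => by simp [← x.2])).1 x.1.2⟩
  invFun b := ⟨⟨fun i => if h : i ∈ Z then 0 else b.1 ⟨i, h⟩ + 1, by
      rw [PK_split c _ Z (fun i => by by_cases h : i ∈ Z <;> simp [h])]
      convert b.2 using 2 with i
      simp [i.2]⟩, by
      ext i
      by_cases h : i ∈ Z <;> simp [h]⟩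
  left_inv x := by
    obtain ⟨⟨a, ha⟩, rfl⟩ := x
    ext i
    by_cases h : a i = 0
    · simp [h]
    · simp [h]; omega
  right_inv b := by
    ext i
    simp [i.2]

theorem PK_count (s : ℕ) : ∀ (ι : Type) [Fintype ι] [DecidableEq ι] (c : ℕ),
    Fintype.card ι + c = s → Finite {a : ι → ℕ // PK c a} ∧
      (Nat.card {a : ι → ℕ // PK c a} : ℚ) = (Fintype.card ι).factorial * uu (Fintype.card ι) c := by
  induction s with
  | zero =>
    intro ι _ _ c h
    have h0 : Fintype.card ι = 0 := by omega
    obtain rfl : c = 0 := by omega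
    have := Fintype.card_eq_zero_iff.1 h0
    have e : ∀ a : ι → ℕ, PK 0 a := by intro a v hv; omega
    refine ⟨inferInstance, ?_⟩
    rw [Nat.card_congr (Equiv.subtypeUnivEquiv e), h0]
    simp [uu]
  | succ s ih =>
    intro ι _ _ c h
    rcases c with _ | c
    · have e : ∀ a : ι → ℕ, ¬ PK 0 a := by
        intro a ha
        have := ha 0 (by omega)
        simp at this
      have : IsEmpty {a : ι → ℕ // PK 0 a} := ⟨fun a => e _ a.2⟩
      refine ⟨inferInstance, ?_⟩
      rw [Nat.card_of_isEmpty, uu_zero, if_neg (by omega)]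
      simp
    · have hc : ∀ Z : Finset ι, Fintype.card {i // i ∉ Z} + #Z = Fintype.card ι := by
        intro Z
        exact cardNot Z
      have IH := fun Z : Finset ι => ih {i // i ∉ Z} (c + #Z) (by have := hc Z; omega)
      have E := (Equiv.sigmaCongrRight (fibEquiv (ι := ι) c)).symm.trans
        (Equiv.sigmaFiberEquiv (fun x : {a : ι → ℕ // PK (c+1) a} => ({i | x.1 i = 0} : Finset ι)))
      have := fun Z => (IH Z).1
      refine ⟨Finite.of_equiv _ E, ?_⟩
      rw [← Nat.card_congr E, Nat.card_sigma]
      push_cast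
      simp_rw [fun Z => (IH Z).2]
      have e : ∀ Z : Finset ι, Fintype.card {i // i ∉ Z} = Fintype.card ι - #Z := by
        intro Z; have := hc Z; omega
      simp_rw [e]
      rw [← Finset.powerset_univ, Finset.sum_powerset_apply_card (fun j =>
        (((Fintype.card ι - j).factorial : ℚ) * uu (Fintype.card ι - j) (c + j))), uu_rec,
        Finset.Nat.sum_antidiagonal_eq_sum_range_succ_mk, Finset.mul_sum]
      refine Finset.sum_congr rfl fun j hj => ?_
      simp only [Finset.card_univ, nsmul_eq_mul]
      have hj' : j ≤ Fintype.card ι := by simp at hj; omega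
      have h5 : ((Fintype.card ι).choose j : ℚ) * j.factorial * (Fintype.card ι - j).factorial
        = (Fintype.card ι).factorial := by exact_mod_cast Nat.choose_mul_factorial_mul_factorial hj'
      rw [← h5]
      have := Nat.factorial_ne_zero j
      field_simp

theorem park_iff (n k : ℕ) (a : Fin n → ℕ) :
    IsParkingFunctionWith n (n+k) a ↔ (∀ i, 1 ≤ a i) ∧ PK (k+1) (fun i => a i - 1) := by
  constructor
  · rintro ⟨h1, σ, hm, hσ⟩
    refine ⟨fun i => (h1 i).1, ?_⟩
    intro v hv
    simp only [Fintype.card_fin] at hv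
    by_cases hvk : v ≤ k
    · omega
    obtain ⟨t, rfl⟩ : ∃ t, v = k + t := ⟨v - k, by omega⟩
    have hsub : (({i : Fin n | (i:ℕ) < t} : Finset (Fin n)).map σ.toEmbedding) ⊆
        ({i | a i - 1 < k + t} : Finset (Fin n)) := by
      intro x hx
      simp only [Finset.mem_map, Finset.mem_filter, Finset.mem_univ, true_and] at hx ⊢
      obtain ⟨i, hi, rfl⟩ := hx
      have := hσ i
      have := (h1 (σ i)).1
      simp only [Equiv.coe_toEmbedding]
      omega
    have := Finset.card_le_card hsub
    rw [Finset.card_map, Fin.card_filter_val_lt] at this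
    simp only
    omega
  · rintro ⟨h1, h⟩
    refine ⟨fun i => ⟨h1 i, ?_⟩, Tuple.sort a, Tuple.monotone_sort a, ?_⟩
    · have h2 := h (n+k) (by simp)
      simp only at h2
      have h3 : #{i | a i - 1 < n + k} = n := by
        have := Finset.card_le_univ ({i | a i - 1 < n + k} : Finset (Fin n))
        simp only [Fintype.card_fin] at this
        omega
      have h4 : ({i | a i - 1 < n + k} : Finset (Fin n)) = Finset.univ := by
        rw [← Finset.card_eq_iff_eq_univ, h3]; simp
      have := Finset.mem_univ i
      rw [← h4] at this
      simp at this
      have := h1 i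
      omega
    · intro i
      by_contra hlt
      have h2 := h (k + (i+1)) (by simp; omega)
      simp only at h2
      have hsub : ({j | a j - 1 < k + (i+1)} : Finset (Fin n)) ⊆
          (({j : Fin n | (j:ℕ) < i} : Finset (Fin n)).map (Tuple.sort a).toEmbedding) := by
        intro x hx
        simp only [Finset.mem_map, Finset.mem_filter, Finset.mem_univ, true_and] at hx ⊢
        refine ⟨(Tuple.sort a).symm x, ?_, by simp⟩
        by_contra hge
        have := Tuple.monotone_sort a (show i ≤ (Tuple.sort a).symm x by
          rw [Fin.le_def]; omega)
        simp at this
        have := h1 x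
        omega
      have := Finset.card_le_card hsub
      rw [Finset.card_map, Fin.card_filter_val_lt] at this
      omega

def parkEquiv (n k : ℕ) : {a : Fin n → ℕ // IsParkingFunctionWith n (n+k) a} ≃
    {a : Fin n → ℕ // PK (k+1) a} where
  toFun a := ⟨fun i => a.1 i - 1, ((park_iff n k a.1).1 a.2).2⟩
  invFun a := ⟨fun i => a.1 i + 1, (park_iff n k _).2 ⟨fun i => by simp, by simpa using a.2⟩⟩
  left_inv a := by
    ext i
    have := ((park_iff n k a.1).1 a.2).1 i
    simp only
    omega
  right_inv a := by
    ext i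
    simp

end Helpers

/-- `p_{n,n+k;≤n+k} = Σ_{r_0+⋯+r_k=n} multinomial(r) · ∏ (r_i+1)^(r_i-1)`. -/
theorem stmt0 (n k : ℕ) :
    pWith n (n + k) =
      ∑ r ∈ Finset.Nat.antidiagonalTuple (k + 1) n,
        Nat.multinomial Finset.univ r * ∏ i, (r i + 1) ^ (r i - 1) := by
  have h := (PK_count _ (Fin n) (k+1) rfl).2
  rw [← Nat.card_congr (parkEquiv n k)] at h
  have h2 := rhs_eq n (k+1)
  rw [Fintype.card_fin] at h
  have h3 := h.trans h2.symm
  unfold pWith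
  exact_mod_cast h3
end

section
/- For all integers n ≥ 0 and k ≥ 1, the number p_{n,n+k;≤n+k} of parking functions of length n with n+k parking spaces satisfies the recurrence p_{n,n+k;≤n+k} = Σ_{i=0}^{n} C(n,i) · p_i · p_{n−i,n+k−1−i;≤n+k−1−i}, where p_i = (i+1)^{i−1} is the number of parking functions of length i. -/
namespace PFaux

open Finset

/-- Counting form of the parking condition on an arbitrary finite index type. -/
def PF (α : Type) [Fintype α] (c : ℕ) (a : α → ℕ) : Prop :=
  (∀ t, 1 ≤ a t) ∧ ∀ j ≤ Fintype.card α, j ≤ #{t | a t ≤ c + j}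

/-- The number of functions satisfying `PF`. -/
noncomputable def cnt (α : Type) [Fintype α] (c : ℕ) : ℕ := Nat.card {a : α → ℕ // PF α c a}

lemma sort_iff (n c : ℕ) (a : Fin n → ℕ) :
    (∃ σ : Equiv.Perm (Fin n), Monotone (a ∘ σ) ∧ ∀ i : Fin n, a (σ i) ≤ c + ((i : ℕ) + 1)) ↔
      ∀ j ≤ n, j ≤ #{t | a t ≤ c + j} := by
  constructor
  · rintro ⟨σ, -, h⟩ j hj
    have h1 : #(univ.map ((Fin.castLEEmb hj).trans σ.toEmbedding)) = j := by simp
    rw [← h1]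
    conv_rhs => rw [h1]
    apply card_le_card
    intro t ht
    simp only [mem_map, mem_univ, true_and] at ht
    obtain ⟨i, rfl⟩ := ht
    have := h (Fin.castLE hj i)
    simp at this ⊢
    omega
  · intro h
    refine ⟨Tuple.sort a, Tuple.monotone_sort a, fun i => ?_⟩
    by_contra hc
    have h1 := h (i + 1) i.2
    have h2 : #{t | a t ≤ c + (i + 1)} ≤ #((Iio i).map (Tuple.sort a).toEmbedding) := by
      apply card_le_card
      intro t ht
      simp only [mem_filter, mem_univ, true_and] at ht
      simp only [mem_map, mem_Iio]
      refine ⟨(Tuple.sort a).symm t, ?_, by simp⟩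
      by_contra hlt
      have := Tuple.monotone_sort a (not_lt.mp hlt)
      simp at this
      omega
    simp at h2
    omega

lemma PF.le {α : Type} [Fintype α] {c : ℕ} {a : α → ℕ} (h : PF α c a) (t : α) :
    a t ≤ c + Fintype.card α := by
  have h1 := h.2 _ le_rfl
  have h2 := eq_univ_of_card _ (le_antisymm (card_le_univ _) h1)
  have := mem_univ t
  rw [← h2] at this
  simpa using this

lemma pN_eq (n : ℕ) : pN n = cnt (Fin n) 0 := by
  unfold pN cnt
  congr! 3 with a
  unfold IsParkingFunction PF
  rw [Fintype.card_fin, ← sort_iff]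
  simp

lemma pWith_eq (n k : ℕ) : pWith n (n + k) = cnt (Fin n) k := by
  unfold pWith cnt
  congr! 3 with a
  unfold IsParkingFunctionWith
  rw [Nat.add_sub_cancel_left, sort_iff]
  constructor
  · rintro ⟨h1, h2⟩
    exact ⟨fun t => (h1 t).1, by simpa using h2⟩
  · intro h
    refine ⟨fun t => ⟨h.1 t, ?_⟩, by simpa using h.2⟩
    have := h.le t
    simp at this
    omega

instance {α : Type} [Fintype α] (c : ℕ) : Finite {a : α → ℕ // PF α c a} := by
  have : Set.Finite (Set.pi Set.univ (fun _ : α => Set.Iic (c + Fintype.card α))) :=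
    Set.Finite.pi fun _ => Set.finite_Iic _
  exact this.subset fun a ha t _ => PF.le ha t

lemma cnt_congr {α β : Type} [Fintype α] [Fintype β] (e : α ≃ β) (c : ℕ) :
    cnt α c = cnt β c := by
  unfold cnt
  refine Nat.card_congr ((Equiv.arrowCongr e (Equiv.refl ℕ)).subtypeEquiv fun a => ?_)
  unfold PF
  rw [Fintype.card_congr e]
  have : ∀ j, #{t | a t ≤ c + j} = #{t | (Equiv.arrowCongr e (Equiv.refl ℕ)) a t ≤ c + j} := by
    intro j
    refine card_bij (fun t _ => e t) ?_ ?_ ?_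
    · simp
    · simp
    · intro b hb
      exact ⟨e.symm b, by simpa using hb, by simp⟩
  simp only [this]
  refine and_congr ?_ Iff.rfl
  constructor
  · intro h t; simpa using h _
  · intro h t; simpa using h (e t)

lemma card_sub {α : Type} [Fintype α] (p q : α → Prop) [DecidablePred p] [DecidablePred q]
    [Fintype {x // p x}] :
    #{t : {x // p x} | q t} = #{t | p t ∧ q t} := by
  refine card_bij (fun t _ => t.1) ?_ ?_ ?_
  · rintro ⟨t, ht⟩ h; simpa [ht] using h
  · intro a _ b _ h; exact Subtype.ext h
  · intro b hb
    simp at hb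
    exact ⟨⟨b, hb.1⟩, by simpa using hb.2, rfl⟩

lemma card_split {α : Type} [Fintype α] (p q : α → Prop) [DecidablePred p] [DecidablePred q] :
    #{t | q t} = #{t | p t ∧ q t} + #{t | ¬ p t ∧ q t} := by
  rw [← card_filter_add_card_filter_not (s := {t | q t}) p, filter_filter, filter_filter]
  simp only [and_comm]

/-- Glue two functions, shifting the second one. -/
def glue {α : Type} [Fintype α] [DecidableEq α] (S : Finset α) (b : {x // x ∈ S} → ℕ)
    (c : {x // x ∉ S} → ℕ) (t : α) : ℕ :=
  if h : t ∈ S then b ⟨t, h⟩ else c ⟨t, h⟩ + (#S + 1)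

section
variable {α : Type} [Fintype α] [DecidableEq α] {S : Finset α} {b : {x // x ∈ S} → ℕ}
    {c : {x // x ∉ S} → ℕ}

lemma card_compl' : Fintype.card {x // x ∉ S} + #S = Fintype.card α := by
  have := Fintype.card_subtype_compl (fun x => x ∈ S)
  simp at this ⊢
  have := card_le_univ S
  omega

lemma glue_mem (t : {x // x ∈ S}) : glue S b c t = b t := by simp [glue]
lemma glue_notMem (t : {x // x ∉ S}) : glue S b c t = c t + (#S + 1) := by simp [glue, t.2]

lemma cardS (j : ℕ) : #{t | t ∈ S ∧ glue S b c t ≤ j} = #{t | b t ≤ j} := by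
  rw [← card_sub (fun t => t ∈ S) (fun t => glue S b c t ≤ j)]
  simp only [glue_mem]

lemma cardSc (j : ℕ) :
    #{t | t ∉ S ∧ glue S b c t ≤ j} = #{t | c t + (#S + 1) ≤ j} := by
  rw [← card_sub (fun t => t ∉ S) (fun t => glue S b c t ≤ j)]
  simp only [glue_notMem]

lemma glue_PF {k : ℕ} (hb : PF _ 0 b) (hc : PF _ k c) : PF α (k + 1) (glue S b c) := by
  refine ⟨fun t => ?_, fun j hj => ?_⟩
  · unfold glue; split
    · exact hb.1 _
    · omega
  · rw [card_split (fun t => t ∈ S), cardS, cardSc]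
    have h0 := card_compl' (S := S)
    rcases le_total j #S with h | h
    · have h1 := hb.2 j (by simpa using h)
      have h2 : #{t | b t ≤ 0 + j} ≤ #{t | b t ≤ k + 1 + j} :=
        card_le_card (monotone_filter_right _ fun t _ ht => by omega)
      omega
    · have h1 := hb.2 #S (by simp)
      have h2 : #{t | b t ≤ 0 + #S} ≤ #{t | b t ≤ k + 1 + j} :=
        card_le_card (monotone_filter_right _ fun t _ ht => by omega)
      have h3 := hc.2 (j - #S) (by omega)
      have h4 : #{t | c t ≤ k + (j - #S)} ≤ #{t | c t + (#S + 1) ≤ k + 1 + j} :=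
        card_le_card (monotone_filter_right _ fun t _ ht => by omega)
      omega

lemma glue_set (hb : PF _ 0 b) (hc : ∀ t, 1 ≤ c t) :
    S = ({t | glue S b c t ≤ #S + 1} : Finset α) := by
  ext t
  simp only [mem_filter, mem_univ, true_and]
  by_cases h : t ∈ S
  · have h1 := hb.le ⟨t, h⟩
    simp at h1
    simp [glue, h]; omega
  · have := hc ⟨t, h⟩
    simp [glue, h]; omega

lemma glue_card_le {a : α → ℕ} {S' : Finset α} {b' : {x // x ∈ S'} → ℕ}
    {c' : {x // x ∉ S'} → ℕ} (hb : PF _ 0 b) (hc : ∀ t, 1 ≤ c t) (hb' : PF _ 0 b')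
    (h : glue S b c = a) (h' : glue S' b' c' = a) : #S' ≤ #S := by
  by_contra hlt
  have h1 := congrArg card (glue_set hb hc)
  have h2 := hb'.2 (#S + 1) (by simp; omega)
  rw [← cardS (c := c')] at h2
  rw [h'] at h2
  rw [h] at h1
  have h3 : #{t | t ∈ S' ∧ a t ≤ 0 + (#S + 1)} ≤ #{t | a t ≤ #S + 1} :=
    card_le_card (monotone_filter_right _ fun t _ ht => by have := ht.2; omega)
  omega

lemma exists_glue {k : ℕ} {a : α → ℕ} (ha : PF α (k + 1) a) :
    ∃ (S : Finset α) (b : {x // x ∈ S} → ℕ) (c : {x // x ∉ S} → ℕ),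
      PF _ 0 b ∧ PF _ k c ∧ glue S b c = a := by
  have hex : ∃ i, #{t | a t ≤ i + 1} ≤ i := ⟨Fintype.card α, card_le_univ _⟩
  classical
  let i := Nat.find hex
  have hi : #{t | a t ≤ i + 1} ≤ i := Nat.find_spec hex
  have hmin : ∀ j ≤ i, j ≤ #{t | a t ≤ j} := by
    intro j hj
    rcases j with _ | j
    · simp
    · have := Nat.find_min hex (m := j) hj
      omega
  clear_value i
  have hsub : ({t | a t ≤ i} : Finset α) ⊆ ({t | a t ≤ i + 1} : Finset α) :=
    monotone_filter_right _ fun t _ ht => by omega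
  have hge := hmin i le_rfl
  have hle := card_le_card hsub
  have heq := eq_of_subset_of_card_le hsub (by omega)
  have hS : #{t | a t ≤ i} = i := by omega
  have hgap : ∀ t, ¬ a t ≤ i → i + 2 ≤ a t := by
    intro t ht
    by_contra hc
    have : t ∈ ({t | a t ≤ i + 1} : Finset α) := by simp; omega
    rw [← heq] at this
    simp at this
    omega
  let S : Finset α := {t | a t ≤ i}
  have hmem : ∀ t, t ∈ S ↔ a t ≤ i := by simp [S]
  have hS' : #S = i := hS
  clear_value S
  have hglue : glue S (fun t => a t) (fun t => a t - (i + 1)) = a := by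
    ext t
    unfold glue
    split
    · rfl
    · rename_i h
      rw [hmem] at h
      have := hgap t h
      simp only [hS']; omega
  refine ⟨S, fun t => a t, fun t => a t - (i + 1), ⟨fun t => ha.1 t, fun j hj => ?_⟩,
    ⟨fun t => ?_, fun j hj => ?_⟩, hglue⟩
  · beta_reduce
    rw [card_sub (fun t => t ∈ S) (fun t => a t ≤ 0 + j)]
    simp at hj
    refine (hmin j (by omega)).trans (card_le_card (monotone_filter_right _ fun t _ ht => ?_))
    rw [hmem]; omega
  · have := hgap t (by rw [← hmem]; exact t.2)
    show 1 ≤ a t - (i + 1)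
    omega
  · have h0 := card_compl' (S := S)
    have h1 := ha.2 (j + i) (by omega)
    rw [card_split (fun t => t ∈ S)] at h1
    have h2 : #{t | t ∈ S ∧ a t ≤ k + 1 + (j + i)} ≤ #S :=
      card_le_card fun t ht => by simp at ht; exact ht.1
    rw [card_sub (fun t => t ∉ S) (fun t => a t - (i + 1) ≤ k + j)]
    have h3 : #{t | t ∉ S ∧ a t ≤ k + 1 + (j + i)} ≤ #{t | t ∉ S ∧ a t - (i + 1) ≤ k + j} :=
      card_le_card (monotone_filter_right _ fun t _ ht => ⟨ht.1, by have := ht.2; omega⟩)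
    omega

end

lemma cnt_succ (α : Type) [Fintype α] [DecidableEq α] (k : ℕ) :
    cnt α (k + 1) = ∑ S : Finset α, cnt {x // x ∈ S} 0 * cnt {x // x ∉ S} k := by
  unfold cnt
  simp only [← Nat.card_prod]
  rw [← Nat.card_sigma]
  symm
  refine Nat.card_eq_of_bijective
    (fun x => ⟨glue x.1 x.2.1.1 x.2.2.1, glue_PF x.2.1.2 x.2.2.2⟩) ⟨?_, ?_⟩
  · rintro ⟨S, ⟨b, hb⟩, ⟨c, hc⟩⟩ ⟨S', ⟨b', hb'⟩, ⟨c', hc'⟩⟩ h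
    have h : glue S b c = glue S' b' c' := congrArg Subtype.val h
    have h1 := glue_card_le hb hc.1 hb' rfl h.symm
    have h2 := glue_card_le hb' hc'.1 hb h.symm rfl
    have h3 := glue_set hb hc.1
    have h4 := glue_set hb' hc'.1
    have hS : S = S' := by
      rw [h3, h4, h, le_antisymm h1 h2]
    subst hS
    have hbb : b = b' := by
      ext t
      rw [← glue_mem (b := b) (c := c), h, glue_mem]
    have hcc : c = c' := by
      ext t
      have := glue_notMem (b := b) (c := c) t
      rw [h, glue_notMem] at this
      omega
    subst hbb hcc
    rfl
  · rintro ⟨a, ha⟩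
    obtain ⟨S, b, c, hb, hc, h⟩ := exists_glue ha
    exact ⟨⟨S, ⟨b, hb⟩, ⟨c, hc⟩⟩, Subtype.ext h⟩

end PFaux

/-- recurrence `p_{n,n+k;≤n+k} = Σ_{i=0}^n C(n,i) p_i p_{n-i,n+k-1-i;≤n+k-1-i}`. -/
theorem stmt1 (n k : ℕ) (hk : 1 ≤ k) :
    pWith n (n + k) =
      ∑ i ∈ Finset.range (n + 1), n.choose i * pN i * pWith (n - i) (n + k - 1 - i) := by
  obtain ⟨k, rfl⟩ : ∃ l, k = l + 1 := ⟨k - 1, by omega⟩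
  rw [PFaux.pWith_eq, PFaux.cnt_succ]
  have h : ∀ S : Finset (Fin n),
      PFaux.cnt {x // x ∈ S} 0 * PFaux.cnt {x // x ∉ S} k =
        (fun i => pN i * pWith (n - i) (n + (k + 1) - 1 - i)) S.card := by
    intro S
    have h1 : S.card ≤ n := by simpa using Finset.card_le_univ S
    have h2 := PFaux.card_compl' (S := S)
    rw [Fintype.card_fin] at h2
    have h3 : n + (k + 1) - 1 - S.card = (n - S.card) + k := by omega
    simp only
    rw [h3, PFaux.pN_eq, PFaux.pWith_eq]
    congr 1
    · exact PFaux.cnt_congr (Fintype.equivFinOfCardEq (by simp)) _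
    · exact PFaux.cnt_congr (Fintype.equivFinOfCardEq (by omega)) _
  rw [Finset.sum_congr rfl fun S _ => h S, ← Finset.powerset_univ,
    Finset.sum_powerset_apply_card (fun i => pN i * pWith (n - i) (n + (k + 1) - 1 - i))]
  simp [mul_assoc]
end

section
/- For all integers n and m with 1 ≤ m ≤ n, the number p_{n,m;≤m;n−m} of (n−m)-flaw preference sets of length n with m parking spaces and all entries at most m equals m^n − Σ_{i=0}^{m−2} C(n,i) · (i+1)^{i−1} · (m−i−1)^{n−i}. -/
open Polynomial in
theorem abel_poly (n : ℕ) :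
    ∑ k ∈ Finset.range (n + 1), (C ((n.choose k : ℚ) * ((k : ℚ) + 1) ^ (k - 1))) *
      (X - C (k : ℚ)) ^ (n - k) = (X + 1) ^ n := by
  induction n with
  | zero => simp
  | succ n ih =>
    rw [← sub_eq_zero]
    set P : ℚ[X] := ∑ k ∈ Finset.range (n + 1 + 1),
      (C (((n + 1).choose k : ℚ) * ((k : ℚ) + 1) ^ (k - 1))) *
      (X - C (k : ℚ)) ^ (n + 1 - k) - (X + 1) ^ (n + 1) with hP
    have hd : derivative P = 0 := by
      rw [hP, derivative_sub, derivative_sum, Finset.sum_range_succ]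
      have h2 : derivative ((X + 1 : ℚ[X]) ^ (n + 1)) = C ((n : ℚ) + 1) * (X + 1) ^ n := by
        rw [derivative_pow]
        simp
      rw [h2, ← ih, Finset.mul_sum]
      have : ∀ k ∈ Finset.range (n + 1),
          derivative ((C (((n + 1).choose k : ℚ) * ((k : ℚ) + 1) ^ (k - 1))) *
            (X - C (k : ℚ)) ^ (n + 1 - k)) = C ((n : ℚ) + 1) *
            (C ((n.choose k : ℚ) * ((k : ℚ) + 1) ^ (k - 1)) * (X - C (k : ℚ)) ^ (n - k)) := by
        intro k hk
        have hk' : k ≤ n := by simpa [Nat.lt_succ_iff] using hk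
        have e : ((n + 1).choose k : ℚ) * ((n - k : ℕ) + 1) = (n + 1) * n.choose k := by
          have := Nat.add_one_mul_choose_eq n k
          have h3 := Nat.choose_mul_succ_eq n k
          have h4 : n + 1 - k = (n - k) + 1 := by omega
          rw [h4] at h3
          have h5 : ((n.choose k * (n + 1) : ℕ) : ℚ) = (((n + 1).choose k * (n - k + 1) : ℕ) : ℚ) := by
            rw [h3]
          push_cast at h5
          linarith
        have h4 : n + 1 - k = (n - k) + 1 := by omega
        rw [h4, derivative_C_mul, derivative_pow]
        simp only [derivative_sub, derivative_X, derivative_C, sub_zero, mul_one,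
          Nat.add_sub_cancel]
        rw [← mul_assoc, ← mul_assoc, ← C_mul, ← C_mul]
        congr 2
        push_cast
        linear_combination ((k : ℚ) + 1) ^ (k - 1) * e
      rw [Finset.sum_congr rfl this, Nat.sub_self, pow_zero, mul_one, derivative_C, add_zero, sub_self]
    have hc := derivative_eq_zero.1 hd
    rw [natDegree_eq_zero] at hc
    obtain ⟨c, hc⟩ := hc
    have hev : P.eval (-1) = 0 := by
      have h := congrFun (fwdDiff_iter_pow_eq_zero_of_lt (R := ℚ) (Nat.lt_succ_self n)) 1
      rw [fwdDiff_iter_eq_sum_shift] at h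
      rw [hP]
      simp only [eval_sub, eval_finsetSum, eval_mul, eval_C, eval_pow, eval_X, eval_add, eval_one]
      rw [neg_add_cancel, zero_pow (Nat.succ_ne_zero n), sub_zero]
      refine Eq.trans ?_ h
      refine Finset.sum_congr rfl fun k hk => ?_
      have hk' : k ≤ n + 1 := by simpa [Nat.lt_succ_iff] using hk
      have e : (-1 - (k : ℚ)) = -1 * (k + 1) := by ring
      rw [e, mul_pow]
      simp only [nsmul_eq_mul, mul_one, zsmul_eq_mul]
      push_cast
      rcases Nat.eq_zero_or_pos k with rfl | hpos
      · simp
      · have : ((k : ℚ) + 1) ^ n = (k + 1) ^ (k - 1) * (k + 1) ^ (n + 1 - k) := by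
          rw [← pow_add]; congr 1; omega
        rw [add_comm 1 (k : ℚ), this, Nat.succ_eq_add_one]
        ring
    rw [← hc, eval_C] at hev
    rw [← hc, hev, C_0]

theorem abel_int (n : ℕ) :
    ∑ k ∈ Finset.range (n + 1), ((n.choose k : ℤ) * ((k : ℤ) + 1) ^ (k - 1)) *
      ((n : ℤ) - k - 1) ^ (n - k) = (n : ℤ) ^ n := by
  have h := congrArg (Polynomial.eval ((n : ℚ) - 1)) (abel_poly n)
  simp only [Polynomial.eval_sub, Polynomial.eval_finsetSum, Polynomial.eval_mul,
    Polynomial.eval_C, Polynomial.eval_pow, Polynomial.eval_X, Polynomial.eval_add,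
    Polynomial.eval_one, sub_add_cancel] at h
  have h' : ((∑ k ∈ Finset.range (n + 1), ((n.choose k : ℤ) * ((k : ℤ) + 1) ^ (k - 1)) *
      ((n : ℤ) - k - 1) ^ (n - k) : ℤ) : ℚ) = ((n : ℤ) ^ n : ℤ) := by
    push_cast
    rw [← h]
    refine Finset.sum_congr rfl fun k _ => ?_
    congr 2
    ring
  exact_mod_cast h'


/-- Final set of occupied spaces of the parking process. -/
def parkOcc (m : ℕ) : List ℕ → Finset ℕ → Finset ℕ
  | [], occ => occ
  | p :: rest, occ =>
    match (List.range' p (m + 1 - p)).find? (fun s => decide (s ∉ occ)) with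
    | some s => parkOcc m rest (insert s occ)
    | none => parkOcc m rest occ

theorem park_cases (m p : ℕ) (rest : List ℕ) (occ : Finset ℕ) :
    (∃ s, s ∉ occ ∧ p ≤ s ∧ s ≤ m ∧ (∀ j, p ≤ j → j < s → j ∈ occ) ∧
      parkOcc m (p :: rest) occ = parkOcc m rest (insert s occ) ∧
      flawCount m (p :: rest) occ = flawCount m rest (insert s occ)) ∨
    ((∀ j, p ≤ j → j ≤ m → j ∈ occ) ∧
      parkOcc m (p :: rest) occ = parkOcc m rest occ ∧
      flawCount m (p :: rest) occ = flawCount m rest occ + 1) := by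
  cases h : (List.range' p (m + 1 - p)).find? (fun s => decide (s ∉ occ)) with
  | some s =>
    left
    have h' := List.find?_range'_eq_some.1 h
    obtain ⟨h1, h2, h3⟩ := h'
    rw [List.mem_range'_1] at h2
    refine ⟨s, by simpa using h1, h2.1, by omega, fun j hj hjs => by simpa using h3 j hj hjs, ?_, ?_⟩
    · simp only [parkOcc, h]
    · simp only [flawCount, h]
  | none =>
    right
    have h' := List.find?_range'_eq_none.1 h
    refine ⟨fun j hj hjm => by simpa using h' j hj (by omega), ?_, ?_⟩
    · simp only [parkOcc, h]
    · simp only [flawCount, h]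

theorem park_flaw (m : ℕ) (l : List ℕ) : ∀ occ : Finset ℕ,
    flawCount m l occ + (parkOcc m l occ).card = l.length + occ.card := by
  induction l with
  | nil => intro occ; simp [flawCount, parkOcc]
  | cons p rest ih =>
    intro occ
    rcases park_cases m p rest occ with ⟨s, hs, _, _, _, h1, h2⟩ | ⟨_, h1, h2⟩
    · rw [h1, h2, ih, Finset.card_insert_of_notMem hs, List.length_cons]; omega
    · rw [h1, h2, List.length_cons]; have := ih occ; omega

theorem park_mono (m : ℕ) (l : List ℕ) : ∀ occ : Finset ℕ, occ ⊆ parkOcc m l occ := by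
  induction l with
  | nil => intro occ; simp [parkOcc]
  | cons p rest ih =>
    intro occ
    rcases park_cases m p rest occ with ⟨s, hs, _, _, _, h1, h2⟩ | ⟨_, h1, h2⟩
    · rw [h1]; exact (Finset.subset_insert _ _).trans (ih _)
    · rw [h1]; exact ih _

theorem park_sub (m : ℕ) (l : List ℕ) : ∀ occ : Finset ℕ, (∀ p ∈ l, 1 ≤ p) →
    occ ⊆ Finset.Icc 1 m → parkOcc m l occ ⊆ Finset.Icc 1 m := by
  induction l with
  | nil => intro occ _ h; simpa [parkOcc] using h
  | cons p rest ih =>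
    intro occ hp ho
    have hp1 := hp p (by simp)
    have hp2 : ∀ q ∈ rest, 1 ≤ q := fun q hq => hp q (by simp [hq])
    rcases park_cases m p rest occ with ⟨s, hs, _, _, _, h1, h2⟩ | ⟨_, h1, h2⟩
    · rw [h1]
      refine ih _ hp2 (Finset.insert_subset ?_ ho)
      rw [Finset.mem_Icc]; omega
    · rw [h1]; exact ih _ hp2 ho

theorem park_upper (m j : ℕ) (l : List ℕ) : ∀ occ : Finset ℕ,
    ((parkOcc m l occ).filter (· ≤ j)).card ≤
      (occ.filter (· ≤ j)).card + l.countP (fun p => decide (p ≤ j)) := by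
  induction l with
  | nil => intro occ; simp [parkOcc]
  | cons p rest ih =>
    intro occ
    rw [List.countP_cons]
    rcases park_cases m p rest occ with ⟨s, hs, hps, _, _, h1, h2⟩ | ⟨_, h1, h2⟩
    · rw [h1]
      have := ih (insert s occ)
      rw [Finset.filter_insert] at this
      by_cases hsj : s ≤ j
      · have hpj : p ≤ j := by omega
        rw [if_pos hsj, Finset.card_insert_of_notMem (by simp [hs])] at this
        simp only [hpj, decide_true, if_true]
        omega
      · rw [if_neg hsj] at this
        omega
    · rw [h1]; have := ih occ; omega

theorem park_lower (m j : ℕ) (hj : j ≤ m) (l : List ℕ) : ∀ occ : Finset ℕ,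
    j ∉ parkOcc m l occ →
    (occ.filter (· ≤ j)).card + l.countP (fun p => decide (p ≤ j)) ≤
    ((parkOcc m l occ).filter (· ≤ j)).card := by
  induction l with
  | nil => intro occ; simp [parkOcc]
  | cons p rest ih =>
    intro occ hjo
    rw [List.countP_cons]
    have hjocc : j ∉ occ := fun h => hjo (park_mono _ _ _ h)
    rcases park_cases m p rest occ with ⟨s, hs, hps, _, hall, h1, h2⟩ | ⟨hall, h1, h2⟩
    · rw [h1] at hjo ⊢
      have := ih (insert s occ) hjo
      rw [Finset.filter_insert] at this
      by_cases hsj : s ≤ j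
      · have hpj : p ≤ j := by omega
        rw [if_pos hsj, Finset.card_insert_of_notMem (by simp [hs])] at this
        simp only [hpj, decide_true, if_true]
        omega
      · rw [if_neg hsj] at this
        have hpj : ¬ p ≤ j := fun h => hjocc (hall j h (by omega))
        simp only [hpj, decide_false]
        simpa using this
    · rw [h1] at hjo ⊢
      have := ih occ hjo
      have hpj : ¬ p ≤ j := fun h => hjocc (hall j h hj)
      simp only [hpj, decide_false]
      simpa using this

theorem flaw_iff (m : ℕ) (l : List ℕ) (hl : ∀ p ∈ l, 1 ≤ p) (hm : m ≤ l.length) :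
    flawCount m l ∅ = l.length - m ↔
      ∀ j ≤ m, j ≤ l.countP (fun p => decide (p ≤ j)) := by
  have hf := park_flaw m l ∅
  have hs := park_sub m l ∅ hl (by simp)
  have hc : (Finset.Icc 1 m).card = m := by simp
  have hle := Finset.card_le_card hs
  rw [Finset.card_empty] at hf
  constructor
  · intro h j hj
    have hE : parkOcc m l ∅ = Finset.Icc 1 m := Finset.eq_of_subset_of_card_le hs (by omega)
    have hu := park_upper m j l ∅
    rw [hE] at hu
    have : (Finset.Icc 1 m).filter (· ≤ j) = Finset.Icc 1 j := by
      ext x; simp; omega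
    rw [this] at hu
    simpa using hu
  · intro h
    have hE : parkOcc m l ∅ = Finset.Icc 1 m := by
      refine Finset.Subset.antisymm hs fun j hj => ?_
      by_contra hn
      rw [Finset.mem_Icc] at hj
      have h1 := park_lower m j hj.2 l ∅ hn
      have h2 := h j hj.2
      have h3 : (parkOcc m l ∅).filter (· ≤ j) ⊆ Finset.Icc 1 (j - 1) := by
        intro x hx
        rw [Finset.mem_filter] at hx
        have h4 := Finset.mem_Icc.1 (hs hx.1)
        have h5 : x ≠ j := fun e => hn (e ▸ hx.1)
        rw [Finset.mem_Icc]; omega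
      have h6 := Finset.card_le_card h3
      simp at h6 h1
      omega
    rw [hE] at hf
    omega


open Classical in
/-- Preference functions on `α` that fill all `m` spaces. -/
noncomputable def goodSet (α : Type) [Fintype α] (m : ℕ) : Finset (α → ℕ) :=
  (Fintype.piFinset fun _ : α => Finset.Icc 1 m).filter
    fun a => ∀ j ≤ m, j ≤ (Finset.univ.filter fun x => a x ≤ j).card

theorem mem_goodSet {α : Type} [Fintype α] {m : ℕ} {a : α → ℕ} :
    a ∈ goodSet α m ↔ (∀ x, 1 ≤ a x ∧ a x ≤ m) ∧
      ∀ j ≤ m, j ≤ (Finset.univ.filter fun x => a x ≤ j).card := by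
  classical
  simp [goodSet, Fintype.mem_piFinset]

theorem card_goodSet_congr {α β : Type} [Fintype α] [Fintype β] (e : α ≃ β) (m : ℕ) :
    (goodSet α m).card = (goodSet β m).card := by
  refine Finset.card_equiv (e.arrowCongr (Equiv.refl ℕ)) fun a => ?_
  rw [mem_goodSet, mem_goodSet]
  refine and_congr ?_ ?_
  · simp only [Equiv.arrowCongr_apply, Equiv.coe_refl, Function.comp, id]
    exact ⟨fun h y => h _, fun h x => by simpa using h (e x)⟩
  · refine forall_congr' fun j => imp_congr_right fun _ => ?_
    have : (Finset.univ.filter fun x => a x ≤ j).card =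
        (Finset.univ.filter fun x => (e.arrowCongr (Equiv.refl ℕ)) a x ≤ j).card := by
      refine Finset.card_equiv e fun x => ?_
      simp [Equiv.arrowCongr_apply]
    rw [this]

/-- The class of preference functions whose first empty space is `S.card + 1`, where `S` is the
set of cars that park before it. -/
def InClass {n : ℕ} (m : ℕ) (S : Finset (Fin n)) (a : Fin n → ℕ) : Prop :=
  (fun x : {x // x ∈ S} => a x) ∈ goodSet {x // x ∈ S} S.card ∧
    ∀ x, x ∉ S → S.card + 2 ≤ a x ∧ a x ≤ m

theorem card_filter_sub {n : ℕ} (S : Finset (Fin n)) (a : Fin n → ℕ) (j : ℕ) :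
    (Finset.univ.filter fun x : {x // x ∈ S} => a x ≤ j).card =
      (S.filter fun x => a x ≤ j).card := by
  rw [← Finset.card_map (Function.Embedding.subtype _)]
  congr 1
  ext x
  simp [and_comm]

theorem inClass_iff {n m : ℕ} {S : Finset (Fin n)} {a : Fin n → ℕ} :
    InClass m S a ↔ (∀ x ∈ S, 1 ≤ a x ∧ a x ≤ S.card) ∧
      (∀ j ≤ S.card, j ≤ (S.filter fun x => a x ≤ j).card) ∧
      ∀ x, x ∉ S → S.card + 2 ≤ a x ∧ a x ≤ m := by
  unfold InClass
  rw [mem_goodSet, and_assoc]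
  simp only [card_filter_sub, Subtype.forall]

theorem inClass_filter {n m : ℕ} {S : Finset (Fin n)} {a : Fin n → ℕ} (h : InClass m S a) :
    (Finset.univ.filter fun x => a x ≤ S.card + 1) = S := by
  rw [inClass_iff] at h
  ext x
  simp only [Finset.mem_filter, Finset.mem_univ, true_and]
  by_cases hx : x ∈ S
  · have := h.1 x hx
    simp only [hx, iff_true]; omega
  · have := h.2.2 x hx
    simp only [hx, iff_false]; omega

theorem inClass_le {n m : ℕ} {S T : Finset (Fin n)} {a : Fin n → ℕ} (hS : InClass m S a)
    (hT : InClass m T a) : T.card ≤ S.card := by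
  by_contra hlt
  push Not at hlt
  have h1 := inClass_filter hS
  have h2 := (inClass_iff.1 hT).2.1 (S.card + 1) hlt
  have h3 : (T.filter fun x => a x ≤ S.card + 1) ⊆ S := by
    intro x hx
    rw [← h1]
    simpa using (Finset.mem_filter.1 hx).2
  have := Finset.card_le_card h3
  omega

theorem inClass_unique {n m : ℕ} {S T : Finset (Fin n)} {a : Fin n → ℕ} (hS : InClass m S a)
    (hT : InClass m T a) : S = T := by
  have h := le_antisymm (inClass_le hS hT) (inClass_le hT hS)
  rw [← inClass_filter hS, ← inClass_filter hT, h]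

theorem bad_iff {n m : ℕ} {a : Fin n → ℕ} (ha : ∀ x, 1 ≤ a x ∧ a x ≤ m) :
    (¬ ∀ j ≤ m, j ≤ (Finset.univ.filter fun x => a x ≤ j).card) ↔
      ∃ S : Finset (Fin n), S.card < m ∧ InClass m S a := by
  classical
  constructor
  · intro h
    push Not at h
    obtain ⟨hm, hlt⟩ := Nat.find_spec h
    have hmin : ∀ j, j < Nat.find h → j ≤ (Finset.univ.filter fun x => a x ≤ j).card := by
      intro j hj
      have := Nat.find_min h hj
      by_contra hc
      exact this ⟨by omega, by omega⟩
    generalize Nat.find h = k at hm hlt hmin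
    obtain ⟨i, rfl⟩ : ∃ i, k = i + 1 := ⟨k - 1, by omega⟩
    have h1 := hmin i (Nat.lt_succ_self i)
    have hsub : (Finset.univ.filter fun x => a x ≤ i) ⊆
        (Finset.univ.filter fun x => a x ≤ i + 1) := by
      intro x hx
      simp only [Finset.mem_filter, Finset.mem_univ, true_and] at hx ⊢
      omega
    have hle := Finset.card_le_card hsub
    have hS := Finset.eq_of_subset_of_card_le hsub (by omega)
    have hc : (Finset.univ.filter fun x => a x ≤ i).card = i := by omega
    refine ⟨Finset.univ.filter fun x => a x ≤ i, by omega, inClass_iff.2 ⟨?_, ?_, ?_⟩⟩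
    · intro x hx
      rw [hc]
      exact ⟨(ha x).1, by simpa using hx⟩
    · intro j hj
      rw [hc] at hj
      refine (hmin j (by omega)).trans (Finset.card_le_card ?_)
      intro x hx
      simp only [Finset.mem_filter, Finset.mem_univ, true_and] at hx ⊢
      omega
    · intro x hx
      rw [hc]
      rw [hS] at hx
      simp only [Finset.mem_filter, Finset.mem_univ, true_and] at hx
      exact ⟨by omega, (ha x).2⟩
  · rintro ⟨S, hSm, hS⟩ h
    have := h (S.card + 1) hSm
    rw [inClass_filter hS] at this
    omega

open Classical in
theorem card_class {n m : ℕ} (S : Finset (Fin n)) (hS : S.card < m) :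
    ((Fintype.piFinset fun _ : Fin n => Finset.Icc 1 m).filter (InClass m S)).card =
      (goodSet (Fin S.card) S.card).card * (m - S.card - 1) ^ (n - S.card) := by
  have e : {x // x ∈ S} ≃ Fin S.card := S.equivFin
  rw [← card_goodSet_congr e]
  have h2 : (Fintype.piFinset fun _ : {x // x ∉ S} => Finset.Icc (S.card + 2) m).card =
      (m - S.card - 1) ^ (n - S.card) := by
    rw [Fintype.card_piFinset, Finset.prod_const, Finset.card_univ, Nat.card_Icc,
      Fintype.card_subtype_compl]
    simp only [Fintype.card_fin, Fintype.card_coe]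
    congr 1
    omega
  rw [← h2, ← Finset.card_product]
  refine Finset.card_equiv (Equiv.piEquivPiSubtypeProd (fun x => x ∈ S) (fun _ => ℕ)) fun a => ?_
  simp only [Finset.mem_filter, Fintype.mem_piFinset, Finset.mem_product, Finset.mem_Icc,
    Equiv.piEquivPiSubtypeProd_apply, Subtype.forall]
  unfold InClass
  constructor
  · exact fun h => h.2
  · intro h
    refine ⟨fun x => ?_, h⟩
    by_cases hx : x ∈ S
    · have := (mem_goodSet.1 h.1).1 ⟨x, hx⟩
      simp only at this
      omega
    · have := h.2 x hx
      omega

theorem card_decomp (n m : ℕ) (hnm : m ≤ n) :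
    m ^ n = (goodSet (Fin n) m).card + ∑ i ∈ Finset.range m,
      n.choose i * ((goodSet (Fin i) i).card * (m - i - 1) ^ (n - i)) := by
  classical
  set U := Fintype.piFinset fun _ : Fin n => Finset.Icc 1 m with hU
  have hc : U.card = m ^ n := by simp [hU]
  rw [← hc, ← Finset.card_filter_add_card_filter_not
    (fun a : Fin n → ℕ => ∀ j ≤ m, j ≤ (Finset.univ.filter fun x => a x ≤ j).card)]
  congr 1
  · unfold goodSet
    congr!
  have hb : (U.filter fun a => ¬ ∀ j ≤ m, j ≤ (Finset.univ.filter fun x => a x ≤ j).card) =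
      ((Finset.univ : Finset (Fin n)).powerset.filter fun S => S.card < m).biUnion
        fun S => U.filter (InClass m S) := by
    ext a
    simp only [Finset.mem_filter, Finset.mem_biUnion, Finset.mem_powerset, Finset.subset_univ,
      true_and]
    constructor
    · rintro ⟨ha, h⟩
      have ha' : ∀ x, 1 ≤ a x ∧ a x ≤ m := by simpa [hU, Fintype.mem_piFinset] using ha
      obtain ⟨S, h1, h2⟩ := (bad_iff ha').1 h
      exact ⟨S, h1, ha, h2⟩
    · rintro ⟨S, h1, ha, h2⟩
      have ha' : ∀ x, 1 ≤ a x ∧ a x ≤ m := by simpa [hU, Fintype.mem_piFinset] using ha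
      exact ⟨ha, (bad_iff ha').2 ⟨S, h1, h2⟩⟩
  rw [hb, Finset.card_biUnion]
  · rw [Finset.sum_congr rfl (fun S hS => card_class S (Finset.mem_filter.1 hS).2),
      Finset.sum_filter]
    have := Finset.sum_powerset_apply_card (fun k => if k < m then
      (goodSet (Fin k) k).card * (m - k - 1) ^ (n - k) else 0) (x := (Finset.univ : Finset (Fin n)))
    rw [this, Finset.card_univ, Fintype.card_fin]
    rw [← Finset.sum_subset (Finset.range_subset_range.2 (by omega : m ≤ n + 1))]
    · refine Finset.sum_congr rfl fun i hi => ?_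
      rw [if_pos (Finset.mem_range.1 hi), smul_eq_mul]
    · intro i _ hi
      rw [if_neg (by simpa using hi), smul_zero]
  · intro S _ T _ hST
    rw [Function.onFun, Finset.disjoint_left]
    intro a h1 h2
    exact hST (inClass_unique (Finset.mem_filter.1 h1).2 (Finset.mem_filter.1 h2).2)

theorem decomp_int (n m : ℕ) (hnm : m ≤ n) :
    ((goodSet (Fin n) m).card : ℤ) = (m : ℤ) ^ n - ∑ i ∈ Finset.range m,
      (n.choose i : ℤ) * ((goodSet (Fin i) i).card : ℤ) * ((m : ℤ) - i - 1) ^ (n - i) := by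
  have h := congrArg (Nat.cast : ℕ → ℤ) (card_decomp n m hnm)
  push_cast at h
  rw [h, eq_sub_iff_add_eq]
  congr 1
  refine Finset.sum_congr rfl fun i hi => ?_
  have hi' := Finset.mem_range.1 hi
  have : ((m - i - 1 : ℕ) : ℤ) = (m : ℤ) - i - 1 := by omega
  rw [this, mul_assoc]

theorem card_good_diag (n : ℕ) : ((goodSet (Fin n) n).card : ℤ) = ((n : ℤ) + 1) ^ (n - 1) := by
  induction n using Nat.strong_induction_on with
  | _ n ih =>
    have hs : ∑ i ∈ Finset.range n,
        (n.choose i : ℤ) * ((goodSet (Fin i) i).card : ℤ) * ((n : ℤ) - i - 1) ^ (n - i) =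
        ∑ i ∈ Finset.range n,
        (n.choose i : ℤ) * ((i : ℤ) + 1) ^ (i - 1) * ((n : ℤ) - i - 1) ^ (n - i) :=
      Finset.sum_congr rfl fun i hi => by rw [ih i (Finset.mem_range.1 hi)]
    rw [decomp_int n n le_rfl, hs, ← abel_int n, Finset.sum_range_succ]
    simp

theorem countP_ofFn' {n : ℕ} (a : Fin n → ℕ) (j : ℕ) :
    (List.ofFn a).countP (fun p => decide (p ≤ j)) =
      (Finset.univ.filter fun x => a x ≤ j).card := by
  induction n with
  | zero => simp
  | succ n ih =>
    rw [List.ofFn_succ, List.countP_cons, ih, Fin.card_filter_univ_succ]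
    split_ifs <;> simp_all

theorem pFlaw_eq (n m : ℕ) (h2 : m ≤ n) : pFlaw n m (n - m) = (goodSet (Fin n) m).card := by
  unfold pFlaw
  refine Nat.subtype_card _ fun a => ?_
  rw [mem_goodSet]
  refine and_congr_right fun ha => ?_
  have := flaw_iff m (List.ofFn a) (by
    intro p hp
    obtain ⟨i, rfl⟩ := (List.mem_ofFn' a p).1 hp
    exact (ha i).1) (by simpa using h2)
  rw [List.length_ofFn] at this
  rw [this]
  simp only [countP_ofFn']

/-- `p_{n,m;≤m;n-m} = m^n - Σ_{i=0}^{m-2} C(n,i)(i+1)^{i-1}(m-i-1)^{n-i}`. -/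
theorem stmt2 (n m : ℕ) (h1 : 1 ≤ m) (h2 : m ≤ n) :
    (pFlaw n m (n - m) : ℤ) =
      (m : ℤ) ^ n - ∑ i ∈ Finset.range (m - 1),
        (n.choose i : ℤ) * ((i : ℤ) + 1) ^ (i - 1) * ((m : ℤ) - i - 1) ^ (n - i) := by
  obtain ⟨k, rfl⟩ : ∃ k, m = k + 1 := ⟨m - 1, by omega⟩
  rw [pFlaw_eq n _ h2, decomp_int n _ h2, Finset.sum_range_succ, Nat.add_sub_cancel]
  have h0 : (((k + 1 : ℕ) : ℤ) - k - 1) = 0 := by push_cast; ring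
  rw [h0, zero_pow (by omega), mul_zero, add_zero]
  congr 1
  exact Finset.sum_congr rfl fun i _ => by rw [card_good_diag]
end

section
/- For all integers n and s with 1 ≤ s ≤ n, the number p_{n;≤s} of parking functions of length n with all entries at most s equals the number p_{n,s;≤s;n−s} of (n−s)-flaw preference sets of length n with s parking spaces and all entries at most s. -/
theorem flaw_invariant (s : ℕ) (l : List ℕ) : ∀ occ : Finset ℕ, occ ⊆ Finset.Icc 1 s →
    (∀ x ∈ l, 1 ≤ x ∧ x ≤ s) →
    ∃ F : Finset ℕ, occ ⊆ F ∧ F ⊆ Finset.Icc 1 s ∧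
      flawCount s l occ + F.card = l.length + occ.card ∧
      (∀ i, (F.filter (· ≤ i)).card ≤ (occ.filter (· ≤ i)).card + l.countP (· ≤ i)) ∧
      (∀ i, i ≤ s → i ∉ F →
        l.countP (· ≤ i) + (occ.filter (· ≤ i)).card ≤ (F.filter (· ≤ i)).card) := by
  induction l with
  | nil =>
    intro occ h _
    exact ⟨occ, subset_rfl, h, by simp [flawCount], by simp, by simp⟩
  | cons p rest ih =>
    intro occ h hl
    have hp := hl p (by simp)
    have hr : ∀ x ∈ rest, 1 ≤ x ∧ x ≤ s := fun x hx => hl x (by simp [hx])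
    unfold flawCount
    split
    · rename_i t ht
      rw [List.find?_range'_eq_some] at ht
      obtain ⟨h1, h2, h3⟩ := ht
      have h1' : t ∉ occ := by simpa using h1
      rw [List.mem_range'_1] at h2
      have h3' : ∀ j, p ≤ j → j < t → j ∈ occ := fun j a b => by simpa using h3 j a b
      obtain ⟨F, f1, f2, f3, f4, f5⟩ := ih (insert t occ) (by
        intro x hx
        rcases Finset.mem_insert.1 hx with rfl | hx
        · rw [Finset.mem_Icc]; omega
        · exact h hx) hr
      have hcard : ∀ i, ((insert t occ).filter (· ≤ i)).card
          = (occ.filter (· ≤ i)).card + if t ≤ i then 1 else 0 := by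
        intro i
        rw [Finset.filter_insert]
        split_ifs
        · rw [Finset.card_insert_of_notMem (by simp [h1'])]
        · rfl
      refine ⟨F, fun x hx => f1 (Finset.mem_insert_of_mem hx), f2, ?_, ?_, ?_⟩
      · rw [Finset.card_insert_of_notMem h1'] at f3
        simp only [List.length_cons]; omega
      · intro i
        have := f4 i
        rw [hcard] at this
        simp only [List.countP_cons, decide_eq_true_eq]
        split_ifs at this ⊢ <;> omega
      · intro i hi hiF
        have := f5 i hi hiF
        rw [hcard] at this
        have hio : i ∉ occ := fun hh => hiF (f1 (Finset.mem_insert_of_mem hh))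
        have key : p ≤ i → t ≤ i := by
          intro hpi
          by_contra hc
          exact hio (h3' i hpi (by omega))
        simp only [List.countP_cons, decide_eq_true_eq]
        split_ifs at this ⊢ <;> omega
    · rename_i ht
      rw [List.find?_range'_eq_none] at ht
      have ht' : ∀ j, p ≤ j → j ≤ s → j ∈ occ := fun j a b => by
        simpa using ht j a (by omega)
      obtain ⟨F, f1, f2, f3, f4, f5⟩ := ih occ h hr
      refine ⟨F, f1, f2, ?_, ?_, ?_⟩
      · simp only [List.length_cons]; omega
      · intro i
        have := f4 i
        simp only [List.countP_cons]
        omega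
      · intro i hi hiF
        have := f5 i hi hiF
        have key : ¬ p ≤ i := fun hpi => hiF (f1 (ht' i hpi hi))
        simp only [List.countP_cons, decide_eq_true_eq, if_neg key]
        omega

theorem countP_ofFn_eq {n : ℕ} (a : Fin n → ℕ) (i : ℕ) :
    (List.ofFn a).countP (· ≤ i) = (Finset.univ.filter (fun j => a j ≤ i)).card := by
  induction n with
  | zero => simp
  | succ n ih =>
    rw [List.ofFn_succ, List.countP_cons, ih, Fin.univ_succ, Finset.filter_cons]
    simp only [decide_eq_true_eq]
    split_ifs <;> simp [Finset.filter_map, Function.comp_def]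

theorem flaw_iff_s3 (n s : ℕ) (h2 : s ≤ n) (a : Fin n → ℕ) (ha : ∀ i, 1 ≤ a i ∧ a i ≤ s) :
    flawCount s (List.ofFn a) ∅ = n - s ↔
      ∀ i, i ≤ s → i ≤ (Finset.univ.filter (fun j => a j ≤ i)).card := by
  obtain ⟨F, -, f2, f3, f4, f5⟩ := flaw_invariant s (List.ofFn a) ∅ (by simp) (by
    intro x hx
    obtain ⟨i, rfl⟩ := (List.mem_ofFn' _ _).1 hx
    exact ha i)
  simp only [List.length_ofFn, Finset.card_empty, countP_ofFn_eq, Finset.filter_empty] at f3 f4 f5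
  have hFc := Finset.card_le_card f2
  simp only [Nat.card_Icc] at hFc
  constructor
  · intro h i hi
    have hF : F = Finset.Icc 1 s := Finset.eq_of_subset_of_card_le f2 (by
      simp only [Nat.card_Icc]; omega)
    have := f4 i
    have hI : F.filter (· ≤ i) = Finset.Icc 1 i := by
      ext x; rw [hF]; simp only [Finset.mem_filter, Finset.mem_Icc]; omega
    rw [hI, Nat.card_Icc] at this
    omega
  · intro h
    have hF : F = Finset.Icc 1 s := by
      refine Finset.Subset.antisymm f2 fun i hi => ?_
      rw [Finset.mem_Icc] at hi
      by_contra hc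
      have h5 := f5 i hi.2 hc
      have h6 := h i hi.2
      have : (F.filter (· ≤ i)).card ≤ (Finset.Icc 1 (i - 1)).card := by
        apply Finset.card_le_card
        intro x hx
        rw [Finset.mem_filter] at hx
        have h7 := Finset.mem_Icc.1 (f2 hx.1)
        have h8 : x ≠ i := fun e => hc (e ▸ hx.1)
        rw [Finset.mem_Icc]
        omega
      rw [Nat.card_Icc] at this
      omega
    rw [hF, Nat.card_Icc] at f3
    omega

theorem parking_iff (n s : ℕ) (h2 : s ≤ n) (a : Fin n → ℕ) (ha : ∀ i, 1 ≤ a i ∧ a i ≤ s) :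
    IsParkingFunction n a ↔
      ∀ i, i ≤ s → i ≤ (Finset.univ.filter (fun j => a j ≤ i)).card := by
  have hc : ∀ (σ : Equiv.Perm (Fin n)) (i : ℕ),
      (Finset.univ.filter (fun j => (a ∘ σ) j ≤ i)).card
        = (Finset.univ.filter (fun j => a j ≤ i)).card := by
    intro σ i
    refine Finset.card_bij (fun j _ => σ j) (by simp) (by simp) ?_
    intro b hb
    exact ⟨σ.symm b, by simpa using hb, by simp⟩
  constructor
  · rintro ⟨-, σ, hm, hσ⟩ i hi
    rcases Nat.eq_zero_or_pos i with rfl | hpos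
    · simp
    rw [← hc σ i]
    have hlt : i - 1 < n := by omega
    have := (Tuple.lt_card_le_iff_apply_le_of_monotone (f := a ∘ σ) (a := i)
      (j := ⟨i - 1, hlt⟩) hm).2
      (by have := hσ ⟨i - 1, hlt⟩; simp only [Function.comp] at *; omega)
    simp only at this
    omega
  · intro h
    refine ⟨fun i => (ha i).1, Tuple.sort a, Tuple.monotone_sort a, fun i => ?_⟩
    by_cases his : (i : ℕ) + 1 ≤ s
    · have h6 := h _ his
      rw [← hc (Tuple.sort a)] at h6
      exact (Tuple.lt_card_le_iff_apply_le_of_monotone (j := i) (Tuple.monotone_sort a)).1 (by omega)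
    · have := (ha (Tuple.sort a i)).2
      omega

/-- `p_{n;≤s} = p_{n,s;≤s;n-s}` for `1 ≤ s ≤ n`. -/
theorem stmt3 (n s : ℕ) (h1 : 1 ≤ s) (h2 : s ≤ n) :
    pLe n s = pFlaw n s (n - s) := by
  unfold pLe pFlaw
  refine Nat.card_congr (Equiv.subtypeEquivRight fun a => ?_)
  constructor
  · rintro ⟨h, hs⟩
    have ha : ∀ i, 1 ≤ a i ∧ a i ≤ s := fun i => ⟨h.1 i, hs i⟩
    exact ⟨ha, (flaw_iff_s3 n s h2 a ha).2 ((parking_iff n s h2 a ha).1 h)⟩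
  · rintro ⟨ha, h⟩
    exact ⟨(parking_iff n s h2 a ha).2 ((flaw_iff_s3 n s h2 a ha).1 h), fun i => (ha i).2⟩
end

section
/- For all integers n and k with 0 ≤ k ≤ n−1, the number p_{n;≤n−k} of parking functions of length n with all entries at most n−k equals Σ_{i=0}^{k+1} (−1)^i · C(n,i) · (n−i+1)^{n−i−1} · (k+1−i)^i. -/
open Finset in
/-- Parking condition via counting. -/
theorem pk_iff (n : ℕ) (a : Fin n → ℕ) :
    IsParkingFunction n a ↔
      (∀ i, 1 ≤ a i) ∧ ∀ m, m ≤ n → m ≤ #{i | a i ≤ m} := by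
  have key : ∀ σ : Equiv.Perm (Fin n), Monotone (a ∘ σ) →
      ((∀ i : Fin n, a (σ i) ≤ (i : ℕ) + 1) ↔ ∀ m, m ≤ n → m ≤ #{i | a i ≤ m}) := by
    intro σ hσ
    have hc : ∀ m, #{i | (a ∘ σ) i ≤ m} = #{i | a i ≤ m} := by
      intro m
      refine Finset.card_bij (fun i _ => σ i) ?_ ?_ ?_
      · intro i hi
        simpa using hi
      · intro i _ j _ hij
        exact σ.injective hij
      · intro b hb
        exact ⟨σ.symm b, by simpa using hb, by simp⟩
    constructor
    · intro h m hm
      rcases m with _ | m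
      · exact Nat.zero_le _
      · have := (Tuple.lt_card_le_iff_apply_le_of_monotone (f := a ∘ σ) (j := ⟨m, hm⟩)
          (a := m + 1) hσ).2 (h ⟨m, hm⟩)
        rw [hc] at this
        exact this
    · intro h i
      refine (Tuple.lt_card_le_iff_apply_le_of_monotone (f := a ∘ σ) (j := i)
          (a := (i : ℕ) + 1) hσ).1 ?_
      rw [hc]
      exact h (i + 1) i.2
  unfold IsParkingFunction
  constructor
  · rintro ⟨h1, σ, hσ, h2⟩
    exact ⟨h1, (key σ hσ).1 h2⟩
  · rintro ⟨h1, h2⟩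
    exact ⟨h1, Tuple.sort a, Tuple.monotone_sort a, (key _ (Tuple.monotone_sort a)).2 h2⟩

open Finset in
/-- Functions supported on `S` with values in `[1,s]` on `S` and enough small values. -/
def pkG {n : ℕ} (S : Finset (Fin n)) (s : ℕ) : Finset (Fin n → ℕ) :=
  {a ∈ Fintype.piFinset (fun i => if i ∈ S then Icc 1 s else {0}) |
    ∀ m ≤ s, m ≤ #{i ∈ S | a i ≤ m}}

open Finset in
theorem mem_pkG {n : ℕ} (S : Finset (Fin n)) (s : ℕ) (a : Fin n → ℕ) :
    a ∈ pkG S s ↔ (∀ i ∈ S, 1 ≤ a i ∧ a i ≤ s) ∧ (∀ i ∉ S, a i = 0) ∧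
      ∀ m ≤ s, m ≤ #{i ∈ S | a i ≤ m} := by
  simp only [pkG, mem_filter, Fintype.mem_piFinset]
  rw [← and_assoc]
  refine and_congr_left fun _ => ?_
  constructor
  · intro h
    refine ⟨fun i hi => ?_, fun i hi => ?_⟩
    · have := h i
      simpa [hi] using this
    · have := h i
      simpa [hi] using this
  · rintro ⟨h1, h2⟩ i
    by_cases hi : i ∈ S
    · simpa [hi] using h1 i hi
    · simpa [hi] using h2 i hi

open Finset in
theorem pkG_succ {n : ℕ} (S : Finset (Fin n)) (s : ℕ) (h : s + 1 ≤ #S) :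
    #(pkG S (s + 1)) = ∑ T ∈ S.powerset, #(pkG T s) := by
  rw [card_eq_sum_card_fiberwise (f := fun a => ({i ∈ S | a i ≤ s} : Finset (Fin n)))
    (t := S.powerset)]
  · refine sum_congr rfl fun T hT => ?_
    rw [mem_powerset] at hT
    refine card_bij' (fun a _ => fun i => if i ∈ T then a i else 0)
      (fun b _ => fun i => if i ∈ T then b i else if i ∈ S then s + 1 else 0) ?_ ?_ ?_ ?_
    · intro a ha
      rw [mem_filter, mem_pkG] at ha
      obtain ⟨⟨h1, h2, h3⟩, h4⟩ := ha
      have hm : ∀ i, i ∈ T ↔ i ∈ S ∧ a i ≤ s := by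
        intro i
        rw [← h4, mem_filter]
      rw [mem_pkG]
      refine ⟨fun i hi => ?_, fun i hi => by simp [hi], fun m hms => ?_⟩
      · simp only [hi, if_true]
        exact ⟨(h1 i (hT hi)).1, ((hm i).1 hi).2⟩
      · refine (h3 m (by omega)).trans (card_le_card ?_)
        intro i hi
        rw [mem_filter] at hi ⊢
        have : i ∈ T := (hm i).2 ⟨hi.1, by omega⟩
        simp [this, hi.2]
    · intro b hb
      rw [mem_pkG] at hb
      obtain ⟨h1, h2, h3⟩ := hb
      rw [mem_filter, mem_pkG]
      refine ⟨⟨fun i hi => ?_, fun i hi => ?_, fun m hms => ?_⟩, ?_⟩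
      · by_cases hiT : i ∈ T
        · have := h1 i hiT
          simp only [hiT, if_true]
          omega
        · simp [hiT, hi]
      · have : i ∉ T := fun hh => hi (hT hh)
        simp [this, hi]
      · rcases Nat.lt_or_ge s m with hlt | hge
        · have : m = s + 1 := by omega
          subst this
          refine h.trans (card_le_card fun i hi => ?_)
          rw [mem_filter]
          refine ⟨hi, ?_⟩
          by_cases hiT : i ∈ T
          · have := h1 i hiT
            simp only [hiT, if_true]
            omega
          · simp [hiT, hi]
        · refine (h3 m hge).trans (card_le_card fun i hi => ?_)
          rw [mem_filter] at hi ⊢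
          refine ⟨hT hi.1, ?_⟩
          simp [hi.1, hi.2]
      · ext i
        rw [mem_filter]
        by_cases hiT : i ∈ T
        · have := h1 i hiT
          simp [hiT, hT hiT, this.2]
        · by_cases hiS : i ∈ S <;> simp [hiT, hiS]
    · intro a ha
      rw [mem_filter, mem_pkG] at ha
      obtain ⟨⟨h1, h2, h3⟩, h4⟩ := ha
      funext i
      by_cases hiT : i ∈ T
      · simp [hiT]
      · by_cases hiS : i ∈ S
        · have h5 := h1 i hiS
          have h6 : ¬ (a i ≤ s) := fun hh => hiT (by rw [← h4, mem_filter]; exact ⟨hiS, hh⟩)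
          simp only [hiT, hiS, if_true, if_false]
          omega
        · simp [hiT, hiS, h2 i hiS]
    · intro b hb
      rw [mem_pkG] at hb
      obtain ⟨h1, h2, h3⟩ := hb
      funext i
      by_cases hiT : i ∈ T
      · simp [hiT]
      · simp [hiT, h2 i hiT]
  · intro a _
    exact mem_coe.2 (mem_powerset.2 (filter_subset _ _))

/-- The closed form. -/
def pkF (n s : ℕ) : ℤ :=
  ∑ t ∈ Finset.Ico s (n + 1), (n.choose t : ℤ) * ((t : ℤ) + 1) ^ (t - 1) *
    ((s : ℤ) - 1 - t) ^ (n - t)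

open Finset in
theorem pkF_zero (n : ℕ) : pkF n 0 = if n = 0 then 1 else 0 := by
  split_ifs with h
  · subst h
    simp [pkF]
  · have h1 := congrFun (fwdDiff_iter_pow_eq_zero_of_lt (R := ℤ) (j := n - 1) (n := n) (by omega)) 1
    rw [fwdDiff_iter_eq_sum_shift] at h1
    simp only [Pi.zero_apply] at h1
    rw [← h1, pkF, Finset.range_eq_Ico]
    refine sum_congr rfl fun t ht => ?_
    rw [mem_Ico] at ht
    have e : ((0 : ℕ) : ℤ) - 1 - t = (-1) * ((t : ℤ) + 1) := by push_cast; ring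
    rw [e, mul_pow]
    simp only [smul_eq_mul, nsmul_eq_mul, mul_one]
    rcases Nat.eq_zero_or_pos t with h0 | h0
    · subst h0
      simp
    · have : n - 1 = (t - 1) + (n - t) := by omega
      rw [this, pow_add, add_comm (1 : ℤ)]
      ring

open Finset in
theorem pkF_inner (n t : ℕ) (h : t ≤ n) (x : ℤ) :
    ∑ m ∈ range (n + 1), (n.choose m : ℤ) * ((m.choose t : ℤ) * x ^ (m - t)) =
      (n.choose t : ℤ) * (x + 1) ^ (n - t) := by
  have h0 : ∑ m ∈ range (n + 1), (n.choose m : ℤ) * ((m.choose t : ℤ) * x ^ (m - t)) =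
      ∑ m ∈ Ico t (n + 1), (n.choose m : ℤ) * ((m.choose t : ℤ) * x ^ (m - t)) := by
    symm
    apply sum_subset
    · intro m hm
      rw [mem_Ico] at hm
      exact mem_range.2 hm.2
    · intro m hm hm2
      rw [mem_range] at hm
      rw [mem_Ico] at hm2
      rw [Nat.choose_eq_zero_of_lt (by omega : m < t)]
      simp
  rw [h0, sum_Ico_eq_sum_range, add_pow, mul_sum, show n + 1 - t = n - t + 1 by omega]
  refine sum_congr rfl fun j hj => ?_
  have hc := Nat.choose_mul (n := n) (k := t + j) (s := t) (by omega)
  rw [Nat.add_sub_cancel_left] at hc ⊢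
  have hc' : (n.choose (t + j) : ℤ) * ((t + j).choose t : ℤ) =
    (n.choose t : ℤ) * ((n - t).choose j : ℤ) := by exact_mod_cast hc
  rw [← mul_assoc, hc']
  simp
  ring

open Finset in
theorem pkF_succ (n s : ℕ) (h : s + 1 ≤ n) :
    ∑ m ∈ range (n + 1), (n.choose m : ℤ) * pkF m s = pkF n (s + 1) := by
  have h1 : ∀ m ∈ range (n + 1), (n.choose m : ℤ) * pkF m s =
      ∑ t ∈ Ico s (n + 1), (n.choose m : ℤ) * ((m.choose t : ℤ) *
        ((s : ℤ) - 1 - t) ^ (m - t)) * ((t : ℤ) + 1) ^ (t - 1) := by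
    intro m hm
    rw [mem_range] at hm
    rw [pkF, mul_sum]
    have h2 : ∀ t ∈ Ico s (m + 1), (n.choose m : ℤ) * ((m.choose t : ℤ) *
        ((t : ℤ) + 1) ^ (t - 1) * ((s : ℤ) - 1 - t) ^ (m - t)) =
        (n.choose m : ℤ) * ((m.choose t : ℤ) *
        ((s : ℤ) - 1 - t) ^ (m - t)) * ((t : ℤ) + 1) ^ (t - 1) := by
      intro t _
      ring
    rw [sum_congr rfl h2]
    apply sum_subset
    · intro t ht
      rw [mem_Ico] at ht ⊢
      omega
    · intro t ht ht2
      rw [mem_Ico] at ht ht2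
      rw [Nat.choose_eq_zero_of_lt (by omega : m < t)]
      simp
  rw [sum_congr rfl h1, sum_comm]
  have h3 : ∀ t ∈ Ico s (n + 1), ∑ m ∈ range (n + 1), (n.choose m : ℤ) * ((m.choose t : ℤ) *
        ((s : ℤ) - 1 - t) ^ (m - t)) * ((t : ℤ) + 1) ^ (t - 1) =
      (n.choose t : ℤ) * ((t : ℤ) + 1) ^ (t - 1) * (((s + 1 : ℕ) : ℤ) - 1 - t) ^ (n - t) := by
    intro t ht
    rw [mem_Ico] at ht
    rw [← sum_mul, pkF_inner n t (by omega)]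
    have : (s : ℤ) - 1 - t + 1 = ((s + 1 : ℕ) : ℤ) - 1 - t := by push_cast; ring
    rw [this]
    ring
  rw [sum_congr rfl h3, pkF, sum_eq_sum_Ico_succ_bot (by omega)]
  have : (((s + 1 : ℕ) : ℤ) - 1 - s) ^ (n - s) = 0 := by
    rw [show ((s + 1 : ℕ) : ℤ) - 1 - s = 0 by push_cast; ring]
    exact zero_pow (by omega)
  rw [this]
  ring

open Finset in
theorem card_pkG {n : ℕ} (s : ℕ) : ∀ S : Finset (Fin n), (#(pkG S s) : ℤ) = pkF #S s := by
  induction s with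
  | zero =>
    intro S
    rw [pkF_zero]
    split_ifs with h
    · rw [card_eq_zero] at h
      subst h
      have : pkG (∅ : Finset (Fin n)) 0 = {0} := by
        ext a
        rw [mem_pkG, mem_singleton, funext_iff]
        simp
      rw [this]
      simp
    · have : pkG S 0 = ∅ := by
        obtain ⟨i, hi⟩ := card_ne_zero.1 h
        rw [eq_empty_iff_forall_notMem]
        intro a ha
        rw [mem_pkG] at ha
        have := ha.1 i hi
        omega
      rw [this]
      simp
  | succ s ih =>
    intro S
    rcases Nat.lt_or_ge #S (s + 1) with h | h
    · have h1 : pkG S (s + 1) = ∅ := by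
        rw [eq_empty_iff_forall_notMem]
        intro a ha
        rw [mem_pkG] at ha
        have h2 := ha.2.2 (s + 1) le_rfl
        have h3 := card_filter_le S (fun i => a i ≤ s + 1)
        omega
      rw [h1, pkF, Ico_eq_empty (by omega)]
      simp
    · rw [pkG_succ S s h, ← pkF_succ _ _ h]
      push_cast
      rw [sum_congr rfl (fun T _ => ih T), sum_powerset_apply_card (fun m => pkF m s)]
      simp

open Finset in
theorem pLe_eq (n s : ℕ) (h : s ≤ n) : pLe n s = #(pkG (univ : Finset (Fin n)) s) := by
  rw [pLe]
  refine Nat.subtype_card _ fun a => ?_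
  rw [mem_pkG, pk_iff]
  constructor
  · rintro ⟨h1, -, h3⟩
    refine ⟨⟨fun i => (h1 i (mem_univ i)).1, fun m hm => ?_⟩, fun i => (h1 i (mem_univ i)).2⟩
    rcases Nat.lt_or_ge s m with hlt | hge
    · rw [filter_true_of_mem]
      · simpa using hm
      · intro i hi
        have := h1 i hi
        omega
    · exact h3 m hge
  · rintro ⟨⟨h1, h2⟩, h3⟩
    exact ⟨fun i _ => ⟨h1 i, h3 i⟩, fun i hi => absurd (mem_univ i) hi,
      fun m hm => h2 m (by omega)⟩

/-- `p_{n;≤n-k} = Σ_{i=0}^{k+1} (-1)^i C(n,i)(n-i+1)^{n-i-1}(k+1-i)^i`. -/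
theorem stmt4 (n k : ℕ) (h : k + 1 ≤ n) :
    (pLe n (n - k) : ℤ) =
      ∑ i ∈ Finset.range (k + 2),
        (-1) ^ i * (n.choose i : ℤ) * ((n : ℤ) - i + 1) ^ (n - i - 1) *
          ((k : ℤ) + 1 - i) ^ i := by
  rw [pLe_eq n (n - k) (by omega), card_pkG, Finset.card_univ, Fintype.card_fin, pkF,
    Finset.sum_Ico_eq_sum_range, Finset.sum_range_succ, show n + 1 - (n - k) = k + 1 by omega,
    ← Finset.sum_range_reflect]
  have h0 : ((k : ℤ) + 1 - ((k + 1 : ℕ) : ℤ)) ^ (k + 1) = 0 := by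
    push_cast
    simp
  rw [h0, mul_zero, add_zero]
  refine Finset.sum_congr rfl fun i hi => ?_
  rw [Finset.mem_range] at hi
  have e : n - k + (k + 1 - 1 - i) = n - i := by omega
  rw [e, Nat.choose_symm (by omega), show n - (n - i) = i by omega,
    Nat.cast_sub (by omega : k ≤ n), Nat.cast_sub (by omega : i ≤ n),
    show (n : ℤ) - k - 1 - (n - i) = (-1) * ((k : ℤ) + 1 - i) by ring, mul_pow]
  ring
end

section
/- For all integers k ≥ 1 and n ≥ k, the numbers p_{n;≤s} satisfy the recurrence p_{n;≤n−k} = p_{n;≤n−k+1} − Σ_{i=1}^{k} C(n,i) · p_{n−i;≤n−k}. -/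
/-- Counting form of bounded parking functions on an arbitrary finite index type. -/
def QPark (ι : Type) [Fintype ι] (s : ℕ) (a : ι → ℕ) : Prop :=
  (∀ i, 1 ≤ a i) ∧ (∀ i, a i ≤ s) ∧
    ∀ j ≤ s, j ≤ (Finset.univ.filter (fun i => a i ≤ j)).card

theorem qpark_finite (ι : Type) [Fintype ι] (s : ℕ) : Finite {a : ι → ℕ // QPark ι s a} := by
  refine Finite.of_injective
    (fun a : {a : ι → ℕ // QPark ι s a} => fun i => (⟨a.1 i, Nat.lt_succ_of_le (a.2.2.1 i)⟩ : Fin (s+1))) ?_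
  intro a b h
  apply Subtype.ext
  funext i
  have := congrFun h i
  simpa using this

theorem isParking_iff (n : ℕ) (a : Fin n → ℕ) :
    IsParkingFunction n a ↔ (∀ i, 1 ≤ a i) ∧
      ∀ j ≤ n, j ≤ (Finset.univ.filter (fun i => a i ≤ j)).card := by
  unfold IsParkingFunction
  refine and_congr_right fun _ => ⟨?_, ?_⟩
  · rintro ⟨σ, -, h⟩ j hj
    have h1 : ((Finset.univ : Finset (Fin j)).image (fun x => σ (Fin.castLE hj x))) ⊆
        Finset.univ.filter (fun i => a i ≤ j) := by
      intro y hy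
      simp only [Finset.mem_image, Finset.mem_univ, true_and] at hy
      obtain ⟨x, rfl⟩ := hy
      simp only [Finset.mem_filter, Finset.mem_univ, true_and]
      have := h (Fin.castLE hj x)
      have hx := x.2
      simp only [Fin.val_castLE] at this
      omega
    have h2 := Finset.card_le_card h1
    rw [Finset.card_image_of_injective _ (fun x y hxy => by
      simpa using hxy)] at h2
    simpa using h2
  · intro h
    refine ⟨Tuple.sort a, Tuple.monotone_sort a, fun i => ?_⟩
    by_contra hc
    push Not at hc
    have h0 := h (i+1) i.2
    have h1 : Finset.univ.filter (fun x => a x ≤ (i:ℕ)+1) ⊆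
        (Finset.Iio i).image (Tuple.sort a) := by
      intro y hy
      simp only [Finset.mem_filter, Finset.mem_univ, true_and] at hy
      simp only [Finset.mem_image, Finset.mem_Iio]
      refine ⟨(Tuple.sort a).symm y, ?_, by simp⟩
      by_contra hlt
      push Not at hlt
      have := Tuple.monotone_sort a hlt
      simp at this
      omega
    have h2 := (Finset.card_le_card h1).trans Finset.card_image_le
    simp at h2
    omega

theorem pLe_eq_s5 (n s : ℕ) (h : s ≤ n) :
    pLe n s = Nat.card {a : Fin n → ℕ // QPark (Fin n) s a} := by
  unfold pLe
  refine Nat.card_congr (Equiv.subtypeEquivRight fun a => ?_)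
  rw [isParking_iff]
  constructor
  · rintro ⟨⟨h1, h2⟩, h3⟩
    exact ⟨h1, h3, fun j hj => h2 j (hj.trans h)⟩
  · rintro ⟨h1, h3, h2⟩
    refine ⟨⟨h1, fun j hj => ?_⟩, h3⟩
    by_cases hjs : j ≤ s
    · exact h2 j hjs
    · rw [Finset.filter_true_of_mem (fun i _ => (h3 i).trans (by omega))]
      simpa using hj

theorem qpark_zero (ι : Type) [Fintype ι] (s : ℕ) (h : Fintype.card ι < s) :
    Nat.card {a : ι → ℕ // QPark ι s a} = 0 := by
  have : IsEmpty {a : ι → ℕ // QPark ι s a} := by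
    constructor
    rintro ⟨a, -, -, h3⟩
    have := (h3 s le_rfl).trans (Finset.card_le_univ _)
    omega
  exact Nat.card_of_isEmpty

theorem qpark_congr {ι κ : Type} [Fintype ι] [Fintype κ] (e : ι ≃ κ) (s : ℕ) :
    Nat.card {a : ι → ℕ // QPark ι s a} = Nat.card {a : κ → ℕ // QPark κ s a} := by
  refine Nat.card_congr ((Equiv.arrowCongr e (Equiv.refl ℕ)).subtypeEquiv fun a => ?_)
  unfold QPark
  refine and_congr ?_ (and_congr ?_ ?_)
  · simp [e.symm.forall_congr_left]
  · simp [e.symm.forall_congr_left]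
  · refine forall_congr' fun j => forall_congr' fun _ => ?_
    have : (Finset.univ.filter (fun i => a i ≤ j)).card =
      (Finset.univ.filter (fun i => (Equiv.arrowCongr e (Equiv.refl ℕ)) a i ≤ j)).card := by
      refine Finset.card_equiv e ?_
      simp
    rw [this]

/-- Extend by the value `s+1` on `S`. -/
def extS {n : ℕ} (s : ℕ) (S : Finset (Fin n)) (b : {x // x ∉ S} → ℕ) (x : Fin n) : ℕ :=
  if h : x ∈ S then s + 1 else b ⟨x, h⟩

theorem card_ext {n : ℕ} (s j : ℕ) (hj : j ≤ s) (S : Finset (Fin n)) (b : {x // x ∉ S} → ℕ) :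
    (Finset.univ.filter (fun i => extS s S b i ≤ j)).card =
      (Finset.univ.filter (fun i => b i ≤ j)).card := by
  symm
  refine Finset.card_bij (fun x _ => x.1) ?_ ?_ ?_
  · intro x hx
    have hx := (Finset.mem_filter.1 hx).2
    refine Finset.mem_filter.2 ⟨Finset.mem_univ _, ?_⟩
    simpa [extS, x.2] using hx
  · intro x _ y _ h
    exact Subtype.ext h
  · intro y hy
    simp only [Finset.mem_filter, Finset.mem_univ, true_and] at hy
    by_cases h : y ∈ S
    · simp [extS, h] at hy
      omega
    · simp [extS, h] at hy
      exact ⟨⟨y, h⟩, by simpa using hy, rfl⟩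

theorem qpark_ext {n : ℕ} (s : ℕ) (hs : s + 1 ≤ n) (S : Finset (Fin n))
    (b : {x // x ∉ S} → ℕ) (hb : ∀ i, b i ≤ s) :
    QPark (Fin n) (s+1) (extS s S b) ↔ QPark _ s b := by
  have hle : ∀ i, extS s S b i ≤ s + 1 := by
    intro i
    unfold extS
    split_ifs with h
    · exact le_rfl
    · exact (hb _).trans (by omega)
  constructor
  · rintro ⟨h1, h2, h3⟩
    refine ⟨fun i => ?_, hb, fun j hj => ?_⟩
    · have := h1 i.1
      simpa [extS, i.2] using this
    · rw [← card_ext s j hj]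
      exact h3 j (by omega)
  · rintro ⟨h1, h2, h3⟩
    refine ⟨fun i => ?_, hle, fun j hj => ?_⟩
    · unfold extS
      split_ifs with h
      · omega
      · exact h1 _
    · by_cases hjs : j ≤ s
      · rw [card_ext s j hjs]
        exact h3 j hjs
      · rw [Finset.filter_true_of_mem (fun i _ => (hle i).trans (by omega))]
        simp
        omega

theorem qpark_succ (n s : ℕ) (hs : s + 1 ≤ n) :
    Nat.card {a : Fin n → ℕ // QPark (Fin n) (s+1) a} =
      ∑ S : Finset (Fin n), Nat.card {b : {x // x ∉ S} → ℕ // QPark _ s b} := by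
  have := fun S : Finset (Fin n) => qpark_finite {x // x ∉ S} s
  rw [← Nat.card_sigma]
  symm
  refine Nat.card_congr (Equiv.ofBijective
    (fun p : (Σ S : Finset (Fin n), {b : {x // x ∉ S} → ℕ // QPark _ s b}) =>
      (⟨extS s p.1 p.2.1, (qpark_ext s hs p.1 p.2.1 p.2.2.2.1).2 p.2.2⟩ :
        {a : Fin n → ℕ // QPark (Fin n) (s+1) a})) ⟨?_, ?_⟩)
  · rintro ⟨S, b, hb⟩ ⟨T, c, hc⟩ h
    have h : extS s S b = extS s T c := congrArg Subtype.val h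
    have hST : S = T := by
      ext x
      have hx := congrFun h x
      unfold extS at hx
      by_cases h1 : x ∈ S <;> by_cases h2 : x ∈ T <;> simp only [h1, h2, dif_pos, dif_neg, not_false_eq_true] at hx ⊢
      · have := hc.2.1 ⟨x, h2⟩
        omega
      · have := hb.2.1 ⟨x, h1⟩
        omega
    subst hST
    have : b = c := by
      funext x
      have hx := congrFun h x.1
      simpa [extS, x.2] using hx
    subst this
    rfl
  · rintro ⟨a, ha⟩
    let S := Finset.univ.filter (fun i => a i = s + 1)
    let b : {x // x ∉ S} → ℕ := fun x => a x.1
    have hb : ∀ i, b i ≤ s := by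
      intro i
      have h1 := ha.2.1 i.1
      have h2 : ¬ a i.1 = s + 1 := by simpa [S] using i.2
      show a i.1 ≤ s
      omega
    have he : extS s S b = a := by
      funext x
      unfold extS
      split_ifs with h
      · have : a x = s + 1 := by simpa [S] using h
        exact this.symm
      · rfl
    exact ⟨⟨S, b, (qpark_ext s hs S b hb).1 (he ▸ ha)⟩, Subtype.ext he⟩

theorem pLe_rec (k n : ℕ) (hk : 1 ≤ k) (hn : k ≤ n) :
    pLe n (n - k + 1) =
      pLe n (n - k) + ∑ i ∈ Finset.Icc 1 k, n.choose i * pLe (n - i) (n - k) := by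
  rw [pLe_eq_s5 n (n-k+1) (by omega), qpark_succ n (n-k) (by omega)]
  have h1 : ∀ S : Finset (Fin n), Nat.card {b : {x // x ∉ S} → ℕ // QPark _ (n-k) b} =
      Nat.card {b : Fin (n - S.card) → ℕ // QPark _ (n-k) b} := by
    intro S
    refine qpark_congr (Fintype.equivFinOfCardEq ?_) _
    simp [Fintype.card_subtype_compl]
  rw [Finset.sum_congr rfl (fun S _ => h1 S), ← Finset.powerset_univ,
    Finset.sum_powerset_apply_card
      (fun i => Nat.card {b : Fin (n - i) → ℕ // QPark _ (n-k) b})]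
  simp only [Finset.card_univ, Fintype.card_fin, smul_eq_mul]
  rw [← Finset.sum_subset (s₁ := Finset.range (k+1))]
  · rw [Finset.sum_range_succ', add_comm]
    congr 1
    · simp [pLe_eq_s5 n (n-k) (by omega)]
    · rw [← Finset.Ico_succ_right_eq_Icc, Finset.sum_Ico_eq_sum_range]
      simp only [Nat.succ_eq_succ, Nat.succ_eq_add_one, Nat.add_sub_cancel, Order.succ_eq_add_one]
      refine Finset.sum_congr rfl fun i hi => ?_
      have := Finset.mem_range.1 hi
      rw [add_comm 1 i, pLe_eq_s5 _ _ (by omega)]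
  · intro x hx
    simp at hx ⊢
    omega
  · intro x hx hx'
    simp at hx hx'
    rw [qpark_zero _ _ (by simp; omega), mul_zero]

/-- `p_{n;≤n-k} = p_{n;≤n-k+1} - Σ_{i=1}^k C(n,i) p_{n-i;≤n-k}`. -/
theorem stmt5 (k n : ℕ) (hk : 1 ≤ k) (hn : k ≤ n) :
    (pLe n (n - k) : ℤ) =
      (pLe n (n - k + 1) : ℤ) -
        ∑ i ∈ Finset.Icc 1 k, (n.choose i : ℤ) * (pLe (n - i) (n - k) : ℤ) := by
  rw [pLe_rec k n hk hn]
  push_cast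
  ring
end

section
/- For all integers k ≥ 1 and n ≥ k, the numbers p_{n;≤s} satisfy the recurrence p_{n;≤n−k} = (n+1)^{n−1} − Σ_{i=1}^{k} C(n,i) · (k−i+1) · (k+1)^{i−1} · p_{n−i;≤n−k}. -/
/-- Condition: entries in `(lo,hi]` and at least `t - c` entries are `≤ t`, for `t ∈ [lo,hi]`. -/
def WCond {ι : Type} [Fintype ι] (lo hi c : ℕ) (a : ι → ℕ) : Prop :=
  (∀ i, lo < a i ∧ a i ≤ hi) ∧
    ∀ t, lo ≤ t → t ≤ hi → t ≤ (Finset.univ.filter (fun i => a i ≤ t)).card + c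

noncomputable def WNum (ι : Type) [Fintype ι] (lo hi c : ℕ) : ℕ :=
  Nat.card {a : ι → ℕ // WCond lo hi c a}

lemma WCond_finite (ι : Type) [Fintype ι] (lo hi c : ℕ) :
    Finite {a : ι → ℕ // WCond lo hi c a} := by
  apply Finite.of_injective (β := ι → Fin (hi + 1))
    (fun a i => ⟨a.1 i, Nat.lt_succ_of_le (a.2.1 i).2⟩)
  intro a b h
  apply Subtype.ext
  funext i
  have := congrFun h i
  simpa using this

lemma WNum_congr {ι κ : Type} [Fintype ι] [Fintype κ] (e : ι ≃ κ) (lo hi c : ℕ) :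
    WNum ι lo hi c = WNum κ lo hi c := by
  unfold WNum
  apply Nat.card_congr
  refine Equiv.subtypeEquiv (Equiv.arrowCongr e (Equiv.refl ℕ)) ?_
  intro a
  unfold WCond
  have h : ∀ t, (Finset.univ.filter (fun i => a i ≤ t)).card =
      (Finset.univ.filter (fun i => (Equiv.arrowCongr e (Equiv.refl ℕ)) a i ≤ t)).card := by
    intro t
    apply Finset.card_equiv e
    intro i
    simp
  simp only [← h]
  refine and_congr ?_ Iff.rfl
  constructor
  · intro h i
    simpa using h (e.symm i)
  · intro h i
    simpa using h (e i)

lemma WNum_split (ι : Type) [Fintype ι] (lo mid hi c : ℕ) (h1 : lo ≤ mid) (h2 : mid ≤ hi) :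
    WNum ι lo hi c = ∑ i ∈ Finset.range (Fintype.card ι + 1),
      (Fintype.card ι).choose i *
        (WNum (Fin i) mid hi (c + (Fintype.card ι - i)) *
          WNum (Fin (Fintype.card ι - i)) lo mid c) := by
  classical
  let F : {a : ι → ℕ // WCond lo hi c a} → Finset ι := fun a => Finset.univ.filter (fun i => mid < a.1 i)
  have key : ∀ S : Finset ι, Nat.card {a // F a = S} =
      WNum (Fin S.card) mid hi (c + (Fintype.card ι - S.card)) *
          WNum (Fin (Fintype.card ι - S.card)) lo mid c := by
    intro S
    have e1 : WNum (Fin S.card) mid hi (c + (Fintype.card ι - S.card)) =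
        WNum {i // i ∈ S} mid hi (c + (Fintype.card ι - S.card)) :=
      WNum_congr (Fintype.equivOfCardEq (by simp)) _ _ _
    have e2 : WNum (Fin (Fintype.card ι - S.card)) lo mid c = WNum {i // ¬ i ∈ S} lo mid c :=
      WNum_congr (Fintype.equivOfCardEq (by simp [Fintype.card_subtype_compl])) _ _ _
    rw [e1, e2]
    unfold WNum
    rw [← Nat.card_prod]
    apply Nat.card_congr
    refine (Equiv.subtypeSubtypeEquivSubtypeInter (fun a : ι → ℕ => WCond lo hi c a)
      (fun a => Finset.univ.filter (fun i => mid < a i) = S)).trans ?_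
    refine Equiv.trans ?_ Equiv.subtypeProdEquivProd
    refine Equiv.subtypeEquiv (Equiv.piEquivPiSubtypeProd (fun i => i ∈ S) (fun _ => ℕ)) ?_
    intro a
    simp only [Equiv.piEquivPiSubtypeProd_apply]
    have hcnt : ∀ t, (Finset.univ.filter (fun i => a i ≤ t)).card =
        (Finset.univ.filter (fun i : {i // i ∈ S} => a i ≤ t)).card +
        (Finset.univ.filter (fun i : {i // ¬ i ∈ S} => a i ≤ t)).card := by
      intro t
      simp only [Finset.card_filter]
      convert (Fintype.sum_subtype_add_sum_subtype (fun i => i ∈ S) (fun i => if a i ≤ t then 1 else 0)).symm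
    have hc2 : Fintype.card {i // ¬ i ∈ S} = Fintype.card ι - S.card := by
      simp [Fintype.card_subtype_compl]
    constructor
    · rintro ⟨⟨ha, hb⟩, hS⟩
      have hS' : ∀ i, i ∈ S ↔ mid < a i := by intro i; rw [← hS]; simp
      refine ⟨⟨fun i => ⟨(hS' i.1).1 i.2, (ha i).2⟩, ?_⟩,
        ⟨fun i => ⟨(ha i).1, not_lt.1 (fun h => i.2 ((hS' i.1).2 h))⟩, ?_⟩⟩
      · intro t ht1 ht2
        have := hb t (by omega) ht2
        have h3 := hcnt t
        have h4 : (Finset.univ.filter (fun i : {i // ¬ i ∈ S} => a i ≤ t)).card ≤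
          Fintype.card {i // ¬ i ∈ S} := Finset.card_le_univ _
        simp only
        omega
      · intro t ht1 ht2
        have := hb t (by omega) (by omega)
        have h3 := hcnt t
        have h4 : (Finset.univ.filter (fun i : {i // i ∈ S} => a i ≤ t)).card = 0 := by
          rw [Finset.card_eq_zero, Finset.filter_eq_empty_iff]
          intro i _
          have := (hS' i.1).1 i.2
          omega
        simp only
        omega
    · rintro ⟨⟨ha, hb⟩, ⟨ha', hb'⟩⟩
      have hS' : ∀ i, i ∈ S ↔ mid < a i := by
        intro i
        constructor
        · intro h; exact (ha ⟨i, h⟩).1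
        · intro h; by_contra h'
          have := (ha' ⟨i, h'⟩).2
          simp only at this
          omega
      refine ⟨⟨?_, ?_⟩, ?_⟩
      · intro i
        by_cases h : i ∈ S
        · have := ha ⟨i, h⟩
          simp only at this
          omega
        · have := ha' ⟨i, h⟩
          simp only at this
          omega
      · intro t ht1 ht2
        rw [hcnt]
        by_cases h : t ≤ mid
        · have := hb' t ht1 h
          simp only at this
          omega
        · have := hb t (by omega) ht2
          simp only at this
          have h4 : (Finset.univ.filter (fun i : {i // ¬ i ∈ S} => a i ≤ t)).card =
              Fintype.card {i // ¬ i ∈ S} := by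
            rw [Finset.filter_true_of_mem]
            · rfl
            · intro i _
              have := (ha' i).2
              simp only at this
              omega
          omega
      · ext i
        simp [hS']
  have := WCond_finite ι lo hi c
  have h3 : WNum ι lo hi c = ∑ S : Finset ι, Nat.card {a // F a = S} := by
    rw [← Nat.card_sigma]
    exact (Nat.card_congr (Equiv.sigmaFiberEquiv F)).symm
  rw [h3]
  simp only [key]
  rw [← Finset.powerset_univ, Finset.sum_powerset_apply_card (fun i =>
    WNum (Fin i) mid hi (c + (Fintype.card ι - i)) * WNum (Fin (Fintype.card ι - i)) lo mid c)]
  simp [Finset.card_univ]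

lemma WNum_zero {ι : Type} [Fintype ι] (lo hi c t : ℕ) (h1 : lo ≤ t) (h2 : t ≤ hi)
    (h : Fintype.card ι + c < t) : WNum ι lo hi c = 0 := by
  unfold WNum
  have : IsEmpty {a : ι → ℕ // WCond lo hi c a} := by
    constructor
    rintro ⟨a, _, ha⟩
    have := ha t h1 h2
    have h4 : (Finset.univ.filter (fun i => a i ≤ t)).card ≤ Fintype.card ι :=
      Finset.card_le_univ _
    omega
  simp

lemma WNum_zero_lo {ι : Type} [Fintype ι] (lo hi c : ℕ) (h2 : lo ≤ hi)
    (h : c < lo) : WNum ι lo hi c = 0 := by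
  unfold WNum
  have : IsEmpty {a : ι → ℕ // WCond lo hi c a} := by
    constructor
    rintro ⟨a, h0, ha⟩
    have := ha lo le_rfl h2
    have h4 : (Finset.univ.filter (fun i => a i ≤ lo)).card = 0 := by
      rw [Finset.card_eq_zero, Finset.filter_eq_empty_iff]
      intro i _
      have := (h0 i).1
      omega
    omega
  simp

lemma WNum_one_step (m lo c : ℕ) (h : lo ≤ c) (h' : lo + 1 ≤ m + c) :
    WNum (Fin m) lo (lo + 1) c = 1 := by
  unfold WNum
  rw [Nat.card_eq_one_iff_unique]
  constructor
  · constructor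
    rintro ⟨a, ha⟩ ⟨b, hb⟩
    apply Subtype.ext
    funext i
    have := ha.1 i
    have := hb.1 i
    simp only
    omega
  · refine ⟨⟨fun _ => lo + 1, fun i => by simp, ?_⟩⟩
    intro t h1 h2
    by_cases ht : t = lo
    · omega
    · have : t = lo + 1 := by omega
      subst this
      simpa using h'

lemma WNum_empty (lo hi c : ℕ) (h : hi ≤ c) : WNum (Fin 0) lo hi c = 1 := by
  unfold WNum
  rw [Nat.card_eq_one_iff_unique]
  constructor
  · constructor
    rintro ⟨a, ha⟩ ⟨b, hb⟩
    apply Subtype.ext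
    funext i
    exact i.elim0
  · refine ⟨⟨fun _ => lo + 1, fun i => i.elim0, ?_⟩⟩
    intro t h1 h2
    omega

lemma sum_choose_deriv (n : ℕ) (M : ℤ) :
    ∑ i ∈ Finset.range (n + 1), (n.choose i : ℤ) * (M ^ i - i * M ^ (i - 1)) =
      (M + 1) ^ n - n * (M + 1) ^ (n - 1) := by
  simp only [mul_sub, Finset.sum_sub_distrib]
  congr 1
  · rw [add_pow]
    apply Finset.sum_congr rfl
    intro i _
    simp [mul_comm]
  · cases n with
    | zero => simp
    | succ n =>
      rw [Finset.sum_range_succ']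
      simp only [Nat.add_sub_cancel]
      rw [add_pow, Finset.mul_sum]
      simp only [Nat.cast_zero, zero_mul, mul_zero, add_zero]
      apply Finset.sum_congr rfl
      intro i _
      have := Nat.add_one_mul_choose_eq n i
      have h : ((n : ℤ) + 1) * (n.choose i : ℤ) = ((n + 1).choose (i + 1) : ℤ) * ((i : ℤ) + 1) := by
        exact_mod_cast this
      simp only [one_pow, mul_one]
      push_cast
      linear_combination (-M ^ i) * h

lemma WNum_formula (L : ℕ) : ∀ (n lo c : ℕ), n + c = lo + L → lo ≤ c + 1 →
    (WNum (Fin n) lo (lo + L) c : ℤ) = ((L : ℤ) + 1) ^ n - n * ((L : ℤ) + 1) ^ (n - 1) := by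
  induction L with
  | zero =>
    intro n lo c h1 h2
    have : n = 0 ∨ n = 1 := by omega
    rcases this with rfl | rfl
    · rw [WNum_empty _ _ _ (by omega)]; simp
    · rw [WNum_zero_lo _ _ _ (by omega) (by omega)]; simp
  | succ L ih =>
    intro n lo c h1 h2
    by_cases hlo : lo ≤ c
    · rw [WNum_split (Fin n) lo (lo + 1) (lo + (L + 1)) c (by omega) (by omega)]
      rw [Fintype.card_fin]
      push_cast
      rw [← sum_choose_deriv]
      apply Finset.sum_congr rfl
      intro i hi
      rw [Finset.mem_range] at hi
      have h3 := ih i (lo + 1) (c + (n - i)) (by omega) (by omega)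
      rw [show lo + (L + 1) = lo + 1 + L by ring, h3]
      congr 1
      by_cases h4 : lo + 1 ≤ (n - i) + c
      · rw [WNum_one_step _ _ _ hlo h4]; simp
      · have : i = L + 1 := by omega
        subst this
        have h0 : ((L : ℤ) + 1) ^ (L + 1) - ((L + 1 : ℕ) : ℤ) * ((L : ℤ) + 1) ^ (L + 1 - 1) = 0 := by
          simp [pow_succ]
          ring
        push_cast at h0 ⊢
        rw [h0, zero_mul]
    · rw [WNum_zero_lo _ _ _ (by omega) (by omega)]
      have : n = L + 1 + 1 := by omega
      subst this
      simp [pow_succ]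
      ring

lemma pLe_eq_WNum (n s : ℕ) (h : s ≤ n) : pLe n s = WNum (Fin n) 0 s 0 := by
  unfold pLe WNum
  apply Nat.card_congr
  refine Equiv.subtypeEquivRight ?_
  intro a
  constructor
  · rintro ⟨⟨h1, σ, hm, hσ⟩, hs⟩
    refine ⟨fun i => ⟨h1 i, hs i⟩, ?_⟩
    intro t _ ht
    have : (Finset.univ.filter (fun i : Fin n => (i : ℕ) < t)).card = t := by
      rw [Fin.card_filter_val_lt]; omega
    rw [add_zero]
    conv_lhs => rw [← this]
    apply Finset.card_le_card_of_injOn σ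
    · intro i hi
      simp only [Finset.coe_filter, Finset.mem_univ, true_and, Set.mem_setOf_eq] at hi ⊢
      have := hσ i
      omega
    · exact σ.injective.injOn
  · rintro ⟨h1, h2⟩
    refine ⟨⟨fun i => (h1 i).1, Tuple.sort a, Tuple.monotone_sort a, ?_⟩, fun i => (h1 i).2⟩
    intro i
    by_contra hc
    push Not at hc
    have hle := (h1 (Tuple.sort a i)).2
    have h3 := h2 (i + 1) (by omega) (by omega)
    have h4 : (Finset.univ.filter (fun j => a j ≤ (i : ℕ) + 1)).card ≤
        (Finset.univ.filter (fun j : Fin n => (j : ℕ) < i)).card := by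
      apply Finset.card_le_card_of_injOn (Tuple.sort a).symm
      · intro j hj
        simp only [Finset.coe_filter, Finset.mem_univ, true_and, Set.mem_setOf_eq] at hj ⊢
        by_contra hcon
        have hij : i ≤ (Tuple.sort a).symm j := by
          rw [Fin.le_def]; omega
        have := Tuple.monotone_sort a hij
        simp at this
        omega
      · exact (Tuple.sort a).symm.injective.injOn
    rw [Fin.card_filter_val_lt] at h4
    omega

/-- `p_{n;≤n-k} = (n+1)^{n-1} - Σ_{i=1}^k C(n,i)(k-i+1)(k+1)^{i-1} p_{n-i;≤n-k}`. -/
theorem stmt6 (k n : ℕ) (hk : 1 ≤ k) (hn : k ≤ n) :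
    (pLe n (n - k) : ℤ) =
      ((n : ℤ) + 1) ^ (n - 1) -
        ∑ i ∈ Finset.Icc 1 k,
          (n.choose i : ℤ) * ((k : ℤ) - i + 1) * ((k : ℤ) + 1) ^ (i - 1) *
            (pLe (n - i) (n - k) : ℤ) := by
  have hmain := WNum_split (Fin n) 0 (n - k) n 0 (by omega) (by omega)
  have hf := WNum_formula n n 0 0 (by omega) (by omega)
  rw [zero_add] at hf
  rw [Fintype.card_fin] at hmain
  have hmain' := congrArg (Nat.cast : ℕ → ℤ) hmain
  rw [hf] at hmain'
  push_cast at hmain'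
  have hsub : Finset.range (k + 1) ⊆ Finset.range (n + 1) := by
    intro x; simp only [Finset.mem_range]; omega
  rw [← Finset.sum_subset hsub] at hmain'
  · rw [Finset.sum_range_succ', Nat.choose_zero_right, WNum_empty _ _ _ (by omega),
      Nat.sub_zero, ← pLe_eq_WNum n (n - k) (by omega)] at hmain'
    have hsum : ∑ i ∈ Finset.Icc 1 k,
          (n.choose i : ℤ) * ((k : ℤ) - i + 1) * ((k : ℤ) + 1) ^ (i - 1) *
            (pLe (n - i) (n - k) : ℤ) =
        ∑ i ∈ Finset.range k, ((n.choose (i + 1) : ℤ) *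
          ((WNum (Fin (i + 1)) (n - k) n (0 + (n - (i + 1))) : ℤ) *
            (WNum (Fin (n - (i + 1))) 0 (n - k) 0 : ℤ))) := by
      rw [Finset.range_eq_Ico, Finset.sum_Ico_add' (fun i => (n.choose i : ℤ) *
          ((WNum (Fin i) (n - k) n (0 + (n - i)) : ℤ) *
            (WNum (Fin (n - i)) 0 (n - k) 0 : ℤ))) 0 k 1]
      apply Finset.sum_congr
      · ext x; simp only [Finset.mem_Icc, Finset.mem_Ico]; omega
      · intro i hi
        rw [Finset.mem_Ico] at hi
        have h3 := WNum_formula k i (n - k) (0 + (n - i)) (by omega) (by omega)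
        rw [show n - k + k = n by omega] at h3
        rw [h3, ← pLe_eq_WNum (n - i) (n - k) (by omega)]
        obtain ⟨j, rfl⟩ : ∃ j, i = j + 1 := ⟨i - 1, by omega⟩
        simp only [Nat.add_sub_cancel]
        push_cast
        ring
    rw [hsum]
    obtain ⟨m, rfl⟩ : ∃ m, n = m + 1 := ⟨n - 1, by omega⟩
    simp only [Nat.add_sub_cancel] at hmain' ⊢
    push_cast at hmain' ⊢
    linear_combination -hmain'
  · intro x hx hx'
    simp only [Finset.mem_range] at hx hx'
    rw [WNum_zero (ι := Fin (n - x)) 0 (n - k) 0 (n - k) (by omega) le_rfl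
      (by rw [Fintype.card_fin]; omega)]
    simp
end

section
/- For all integers l, s, n with 1 ≤ l ≤ s ≤ n, the number p_{n;≤s}^l of parking functions of length n with all entries at most s and first entry equal to l satisfies p_{n;≤s}^l = s^{n−1} − Σ_{i=0}^{l−2} C(n−1,i) · p_i · (s−i−1)^{n−i−1} − Σ_{i=l}^{s−2} C(n−1,i−1) · p_i^l · (s−i−1)^{n−i}, where p_i = (i+1)^{i−1} is the number of parking functions of length i (p_0 = 1) and p_i^l is the number of parking functions of length i with first entry equal to l. -/
open Classical in
/-- Counting form of the parking condition on an arbitrary finite index type. -/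
def IsPark {ι : Type} [Fintype ι] (a : ι → ℕ) : Prop :=
  (∀ i, 1 ≤ a i) ∧ ∀ k ≤ Fintype.card ι, k ≤ (Finset.univ.filter fun j => a j ≤ k).card

theorem isPark_iff (n : ℕ) (a : Fin n → ℕ) : IsParkingFunction n a ↔ IsPark a := by
  classical
  unfold IsParkingFunction IsPark
  refine and_congr_right fun _ => ?_
  constructor
  · rintro ⟨σ, hm, hσ⟩ k hk
    rw [Fintype.card_fin] at hk
    have h : ((Finset.univ : Finset (Fin k)).image fun i => σ (Fin.castLE hk i)) ⊆
        Finset.univ.filter fun j => a j ≤ k := by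
      intro j hj
      simp only [Finset.mem_image, Finset.mem_univ, true_and] at hj
      obtain ⟨i, rfl⟩ := hj
      simp only [Finset.mem_filter, Finset.mem_univ, true_and]
      have := hσ (Fin.castLE hk i)
      simp only [Fin.val_castLE] at this
      omega
    have h2 := Finset.card_le_card h
    rw [Finset.card_image_of_injective _
      (fun x y hxy => Fin.castLE_injective hk (σ.injective hxy))] at h2
    convert h2
    simp
  · intro h
    refine ⟨Tuple.sort a, Tuple.monotone_sort a, fun i => ?_⟩
    by_contra hc
    push Not at hc
    have h1 := h (i + 1) (by rw [Fintype.card_fin]; omega)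
    have h2 : (Finset.univ.filter fun j => a j ≤ (i : ℕ) + 1) ⊆
        (Finset.Iio i).image (Tuple.sort a) := by
      intro j hj
      simp only [Finset.mem_filter, Finset.mem_univ, true_and] at hj
      simp only [Finset.mem_image, Finset.mem_Iio]
      refine ⟨(Tuple.sort a).symm j, ?_, by simp⟩
      by_contra hlt
      push Not at hlt
      have := Tuple.monotone_sort a hlt
      simp at this
      omega
    have h3 := (Finset.card_le_card h2).trans Finset.card_image_le
    rw [Fin.card_Iio] at h3
    have h4 := h1.trans (le_of_eq_of_le (by congr) h3)
    omega

theorem isPark_congr {ι κ : Type} [Fintype ι] [Fintype κ] (e : ι ≃ κ) (a : κ → ℕ) :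
    IsPark (a ∘ e) ↔ IsPark a := by
  classical
  unfold IsPark
  refine and_congr ⟨fun h i => by simpa using h (e.symm i), fun h i => h _⟩ ?_
  rw [Fintype.card_congr e]
  refine forall_congr' fun k => imp_congr_right fun _ => ?_
  have : (Finset.univ.filter fun j => a j ≤ k).card =
      (Finset.univ.filter fun j => (a ∘ e) j ≤ k).card := by
    symm
    apply Finset.card_bij (fun i _ => e i)
    · simp
    · simp
    · intro b hb
      exact ⟨e.symm b, by simpa using hb, by simp⟩
  constructor <;> intro h
  · refine h.trans (le_of_eq ?_)
    convert this.symm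
  · refine h.trans (le_of_eq ?_)
    convert this

theorem IsPark.le_card {ι : Type} [Fintype ι] {a : ι → ℕ} (h : IsPark a) (i : ι) :
    a i ≤ Fintype.card ι := by
  classical
  have h1 := h.2 _ le_rfl
  have h2 := (Finset.card_eq_iff_eq_univ _).1 (le_antisymm (Finset.card_le_univ _) h1)
  have := Finset.mem_univ i
  rw [← h2] at this
  simpa using this

theorem card_isPark {ι : Type} [Fintype ι] :
    Nat.card {a : ι → ℕ // IsPark a} = pN (Fintype.card ι) := by
  unfold pN
  refine Nat.card_congr (Equiv.subtypeEquiv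
    (Equiv.arrowCongr (Fintype.equivFin ι) (Equiv.refl ℕ)) fun a => ?_)
  rw [isPark_iff]
  exact (isPark_congr (Fintype.equivFin ι).symm a).symm

theorem head_iff (n : ℕ) (a : Fin (n + 1) → ℕ) (l : ℕ) :
    (List.ofFn a).head? = some l ↔ a 0 = l := by
  simp [List.ofFn_succ]

theorem card_isPark_first {ι : Type} [Fintype ι] (z : ι) (l : ℕ) :
    Nat.card {a : ι → ℕ // IsPark a ∧ a z = l} = pL (Fintype.card ι) l := by
  classical
  unfold pL
  have hpos : 0 < Fintype.card ι := Fintype.card_pos_iff.2 ⟨z⟩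
  obtain ⟨m, hm⟩ : ∃ m, Fintype.card ι = m + 1 := ⟨_, (Nat.succ_pred_eq_of_pos hpos).symm⟩
  rw [hm]
  let e0 : ι ≃ Fin (m + 1) := Fintype.equivFinOfCardEq hm
  let e : ι ≃ Fin (m + 1) := e0.trans (Equiv.swap (e0 z) 0)
  have he : e.symm 0 = z := by simp [e]
  refine Nat.card_congr (Equiv.subtypeEquiv
    (Equiv.arrowCongr e (Equiv.refl ℕ)) fun a => ?_)
  rw [isPark_iff, head_iff]
  refine and_congr (isPark_congr e.symm a).symm ?_
  simp [he]

theorem card_box {κ : Type} [Fintype κ] (u s : ℕ) :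
    Nat.card {c : κ → ℕ // ∀ j, u ≤ c j ∧ c j ≤ s} = (s + 1 - u) ^ Fintype.card κ := by
  classical
  have : ∀ c : κ → ℕ, c ∈ Fintype.piFinset (fun _ : κ => Finset.Icc u s) ↔
    ∀ j, u ≤ c j ∧ c j ≤ s := by simp [Fintype.mem_piFinset]
  rw [Nat.subtype_card _ this]
  simp

/-- The box with a prescribed entry. -/
noncomputable def boxF {κ : Type} [Fintype κ] [DecidableEq κ] (z : κ) (u s l : ℕ) :
    Finset (κ → ℕ) :=
  Fintype.piFinset (fun j => if j = z then {l} else Finset.Icc u s)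

theorem mem_boxF {κ : Type} [Fintype κ] [DecidableEq κ] (z : κ) (u s l : ℕ) (hu : u ≤ l)
    (hs : l ≤ s) (c : κ → ℕ) :
    c ∈ boxF z u s l ↔ (∀ j, u ≤ c j ∧ c j ≤ s) ∧ c z = l := by
  unfold boxF
  rw [Fintype.mem_piFinset]
  constructor
  · intro h
    have hz : c z = l := by simpa using h z
    refine ⟨fun j => ?_, hz⟩
    by_cases hj : j = z
    · subst hj; omega
    · simpa [hj] using h j
  · rintro ⟨h, hz⟩ j
    by_cases hj : j = z
    · subst hj; simpa using hz
    · simpa [hj] using h j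

theorem card_boxF {κ : Type} [Fintype κ] [DecidableEq κ] (z : κ) (u s l : ℕ) :
    (boxF z u s l).card = (s + 1 - u) ^ (Fintype.card κ - 1) := by
  unfold boxF
  rw [Fintype.card_piFinset, ← Finset.mul_prod_erase _ _ (Finset.mem_univ z),
    Finset.prod_congr rfl (g := fun _ => s + 1 - u)]
  · simp
  · intro j hj
    simp [Finset.ne_of_mem_erase hj]

/-- `a` restricted to `T` is parking, and the rest jumps over `#T + 1`. -/
def Good {n : ℕ} (T : Finset (Fin n)) (a : Fin n → ℕ) : Prop :=
  IsPark (fun j : {x // x ∈ T} => a j) ∧ ∀ j, j ∉ T → T.card + 2 ≤ a j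

theorem Good.mem_iff {n : ℕ} {T : Finset (Fin n)} {a : Fin n → ℕ} (h : Good T a) (j : Fin n)
    (k : ℕ) (hk : T.card ≤ k) (hk' : k ≤ T.card + 1) : a j ≤ k ↔ j ∈ T := by
  constructor
  · intro hj
    by_contra hc
    have := h.2 j hc
    omega
  · intro hj
    have := h.1.le_card ⟨j, hj⟩
    simp at this
    omega

theorem isPark_subtype {n : ℕ} (T : Finset (Fin n)) (a : Fin n → ℕ) :
    IsPark (fun j : {x // x ∈ T} => a j) ↔
      (∀ j ∈ T, 1 ≤ a j) ∧ ∀ k ≤ T.card, k ≤ (T.filter fun j => a j ≤ k).card := by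
  classical
  unfold IsPark
  refine and_congr (by simp) ?_
  rw [Fintype.card_coe]
  refine forall_congr' fun k => imp_congr_right fun _ => ?_
  have : (T.filter fun j => a j ≤ k).card =
      (Finset.univ.filter fun j : {x // x ∈ T} => a j ≤ k).card := by
    symm
    refine Finset.card_bij (fun (i : {x // x ∈ T}) _ => (i : Fin n)) ?_ ?_ ?_
    · simp
    · simp
    · intro b hb
      simp only [Finset.mem_filter] at hb
      exact ⟨⟨b, hb.1⟩, by simpa using hb.2, rfl⟩
  rw [this]

theorem Good.not_lt {n : ℕ} {T T' : Finset (Fin n)} {a : Fin n → ℕ} (h : Good T a)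
    (h' : Good T' a) : ¬ T.card < T'.card := by
  intro hlt
  have h1 := ((isPark_subtype T' a).1 h'.1).2 (T.card + 1) hlt
  have h2 : (T'.filter fun j => a j ≤ T.card + 1) ⊆ T := by
    intro j hj
    rw [Finset.mem_filter] at hj
    exact (h.mem_iff j _ (by omega) le_rfl).1 hj.2
  have := Finset.card_le_card h2
  omega

theorem Good.unique {n : ℕ} {T T' : Finset (Fin n)} {a : Fin n → ℕ} (h : Good T a)
    (h' : Good T' a) : T = T' := by
  have e : T.card = T'.card := by
    have := h.not_lt h'
    have := h'.not_lt h
    omega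
  ext j
  rw [← h.mem_iff j T.card le_rfl (by omega), ← h'.mem_iff j T.card (by omega) (by omega)]

theorem Good.exists {n : ℕ} (a : Fin n → ℕ) (ha : ∀ j, 1 ≤ a j) : ∃ T, Good T a := by
  classical
  by_cases hp : ∃ k, k ≤ n ∧ (Finset.univ.filter fun j => a j ≤ k).card < k
  · have h1 := Nat.find_spec hp
    have h2 := fun m => @Nat.find_min _ _ hp m
    generalize Nat.find hp = k at h1 h2
    obtain ⟨i, rfl⟩ : ∃ i, k = i + 1 := ⟨k - 1, by omega⟩
    have h3 : ∀ m ≤ i, m ≤ (Finset.univ.filter fun j => a j ≤ m).card := by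
      intro m hm
      by_contra hc
      exact h2 m (by omega) ⟨by omega, by omega⟩
    have hsub : (Finset.univ.filter fun j => a j ≤ i) ⊆
        (Finset.univ.filter fun j => a j ≤ i + 1) := by
      intro j hj
      simp only [Finset.mem_filter, Finset.mem_univ, true_and] at hj ⊢
      omega
    have hc := Finset.card_le_card hsub
    have hi := h3 i le_rfl
    have hT : (Finset.univ.filter fun j => a j ≤ i).card = i := by omega
    have heq := Finset.eq_of_subset_of_card_le hsub (by omega)
    refine ⟨Finset.univ.filter fun j => a j ≤ i, ?_, ?_⟩
    · rw [isPark_subtype, hT]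
      refine ⟨fun j _ => ha j, fun k hk => (h3 k hk).trans (Finset.card_le_card ?_)⟩
      intro j hj
      simp only [Finset.mem_filter, Finset.mem_univ, true_and] at hj ⊢
      omega
    · intro j hj
      rw [hT]
      have hj2 := hj
      rw [heq] at hj2
      simp only [Finset.mem_filter, Finset.mem_univ, true_and] at hj2
      omega
  · push Not at hp
    refine ⟨Finset.univ, ?_, by simp⟩
    rw [isPark_subtype]
    exact ⟨fun j _ => ha j, fun k hk => hp k (by simpa using hk)⟩

/-- Number of sequences of type `T`. -/
noncomputable def cnt (m s l : ℕ) (T : Finset (Fin (m + 1))) : ℕ :=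
  Nat.card {a : Fin (m + 1) → ℕ // ((∀ j, 1 ≤ a j ∧ a j ≤ s) ∧ a 0 = l) ∧ Good T a}

theorem sum_cnt (m s l : ℕ) (h1 : 1 ≤ l) (h2 : l ≤ s) :
    ∑ T ∈ (Finset.univ : Finset (Fin (m + 1))).powerset, cnt m s l T = s ^ m := by
  classical
  have hc : ∀ T, cnt m s l T = ((boxF (0 : Fin (m + 1)) 1 s l).filter (Good T)).card := by
    intro T
    unfold cnt
    refine Nat.subtype_card _ fun a => ?_
    rw [Finset.mem_filter, mem_boxF _ _ _ _ h1 h2]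
  simp_rw [hc]
  rw [← Finset.card_biUnion]
  · have : s ^ m = (boxF (0 : Fin (m + 1)) 1 s l).card := by
      rw [card_boxF]; simp
    rw [this]
    congr 1
    ext a
    simp only [Finset.mem_biUnion, Finset.mem_filter, Finset.powerset_univ, Finset.mem_univ,
      true_and]
    constructor
    · rintro ⟨T, h, _⟩; exact h
    · intro h
      obtain ⟨T, hT⟩ := Good.exists a (fun j => (((mem_boxF _ _ _ _ h1 h2 a).1 h).1 j).1)
      exact ⟨T, h, hT⟩
  · intro T _ T' _ hne
    rw [Function.onFun, Finset.disjoint_left]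
    intro a ha ha'
    exact hne ((Finset.mem_filter.1 ha).2.unique (Finset.mem_filter.1 ha').2)

/-- Splitting a count along a subset. -/
theorem card_split_s8 {n : ℕ} (T : Finset (Fin n)) (R : (Fin n → ℕ) → Prop)
    (P : ({x // x ∈ T} → ℕ) → Prop) (Q : ({x // ¬ x ∈ T} → ℕ) → Prop)
    (h : ∀ a : Fin n → ℕ, R a ↔ P (fun j => a j) ∧ Q (fun j => a j)) :
    Nat.card {a // R a} = Nat.card {b // P b} * Nat.card {c // Q c} := by
  classical
  rw [← Nat.card_prod]
  refine Nat.card_congr ((Equiv.subtypeEquiv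
    (Equiv.piEquivPiSubtypeProd (fun x => x ∈ T) (fun _ => ℕ))
      (q := fun x => P x.1 ∧ Q x.2) ?_).trans Equiv.subtypeProdEquivProd)
  intro a
  exact h a

theorem cnt_univ (m s l : ℕ) : cnt m s l Finset.univ = pLeL (m + 1) s l := by
  unfold cnt pLeL
  refine Nat.card_congr (Equiv.subtypeEquivRight fun a => ?_)
  rw [isPark_iff, head_iff]
  have : Good Finset.univ a ↔ IsPark a := by
    unfold Good
    simp only [Finset.mem_univ, not_true_eq_false, false_imp_iff, implies_true, and_true]
    exact isPark_congr (Equiv.subtypeUnivEquiv (p := fun x => x ∈ Finset.univ)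
      Finset.mem_univ) a
  rw [this]
  constructor
  · rintro ⟨⟨h, h0⟩, hp⟩
    exact ⟨hp, fun j => (h j).2, h0⟩
  · rintro ⟨hp, h, h0⟩
    exact ⟨⟨fun j => ⟨hp.1 j, h j⟩, h0⟩, hp⟩

theorem cnt_mem (m s l : ℕ) (T : Finset (Fin (m + 1)))
    (h0 : 0 ∈ T) (hT : T ≠ Finset.univ) :
    cnt m s l T = pL T.card l * (s - T.card - 1) ^ (m + 1 - T.card) := by
  classical
  unfold cnt
  have hk : Fintype.card {x // ¬ x ∈ T} = m + 1 - T.card := by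
    rw [Fintype.card_subtype_compl, Fintype.card_fin, Fintype.card_coe]
  have h := card_split_s8 T
    (fun a => ((∀ j, 1 ≤ a j ∧ a j ≤ s) ∧ a 0 = l) ∧ Good T a)
    (fun b => IsPark b ∧ b ⟨0, h0⟩ = l) (fun c => ∀ j, T.card + 2 ≤ c j ∧ c j ≤ s) ?_
  · rw [h, card_isPark_first, card_box, hk, Fintype.card_coe]
    congr 2
    omega
  · intro a
    constructor
    · rintro ⟨⟨h, h0⟩, hp, hq⟩
      exact ⟨⟨hp, h0⟩, fun j => ⟨hq j j.2, (h j).2⟩⟩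
    · rintro ⟨⟨hp, h0⟩, hq⟩
      refine ⟨⟨fun j => ?_, h0⟩, hp, fun j hj => (hq ⟨j, hj⟩).1⟩
      obtain ⟨z, hz⟩ : ∃ z, z ∉ T := by
        by_contra hc
        push Not at hc
        exact hT (Finset.eq_univ_iff_forall.2 hc)
      have hz' := hq ⟨z, hz⟩
      by_cases hj : j ∈ T
      · have u1 := hp.1 ⟨j, hj⟩
        have u2 := hp.le_card ⟨j, hj⟩
        rw [Fintype.card_coe] at u2
        simp only at u1 u2 hz'
        omega
      · have := hq ⟨j, hj⟩
        simp only at this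
        omega

theorem cnt_not_mem (m s l : ℕ) (h2 : l ≤ s) (T : Finset (Fin (m + 1)))
    (h0 : 0 ∉ T) :
    cnt m s l T = if T.card + 2 ≤ l then pN T.card * (s - T.card - 1) ^ (m - T.card) else 0 := by
  classical
  unfold cnt
  split_ifs with hl
  · have hk : Fintype.card {x // ¬ x ∈ T} = m + 1 - T.card := by
      rw [Fintype.card_subtype_compl, Fintype.card_fin, Fintype.card_coe]
    have h := card_split_s8 T
      (fun a => ((∀ j, 1 ≤ a j ∧ a j ≤ s) ∧ a 0 = l) ∧ Good T a)
      (fun b => IsPark b) (fun c => (∀ j, T.card + 2 ≤ c j ∧ c j ≤ s) ∧ c ⟨0, h0⟩ = l) ?_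
    · rw [h, card_isPark, Nat.subtype_card _ (mem_boxF _ _ _ _ hl h2), card_boxF, hk,
        Fintype.card_coe]
      congr 2 <;> omega
    · intro a
      constructor
      · rintro ⟨⟨h, h0⟩, hp, hq⟩
        exact ⟨hp, fun j => ⟨hq j j.2, (h j).2⟩, h0⟩
      · rintro ⟨hp, hq, h0⟩
        refine ⟨⟨fun j => ?_, h0⟩, hp, fun j hj => (hq ⟨j, hj⟩).1⟩
        by_cases hj : j ∈ T
        · have u1 := hp.1 ⟨j, hj⟩
          have u2 := hp.le_card ⟨j, hj⟩
          rw [Fintype.card_coe] at u2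
          simp only at u1 u2
          omega
        · have := hq ⟨j, hj⟩
          simp only at this
          omega
  · rw [Nat.card_eq_zero]
    left
    refine ⟨fun ⟨a, ha⟩ => ?_⟩
    have := ha.2.2 0 h0
    have := ha.1.2
    omega

theorem pL_eq_zero (i l : ℕ) (h : i < l) : pL (i) l = 0 := by
  unfold pL
  rw [Nat.card_eq_zero]
  left
  refine ⟨fun ⟨a, ha, hl⟩ => ?_⟩
  cases i with
  | zero => simp at hl
  | succ i =>
    rw [head_iff] at hl
    have := ((isPark_iff _ a).1 ha).le_card 0
    rw [Fintype.card_fin] at this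
    omega

theorem key (m s l : ℕ) (h1 : 1 ≤ l) (h2 : l ≤ s) :
    s ^ m = (∑ k ∈ Finset.range (m + 1),
        m.choose k * (if k + 2 ≤ l then pN k * (s - k - 1) ^ (m - k) else 0)) +
      ((∑ k ∈ Finset.range m, m.choose k * (pL (k + 1) l * (s - (k + 1) - 1) ^ (m - k))) +
        pLeL (m + 1) s l) := by
  classical
  rw [← sum_cnt m s l h1 h2]
  have hu : (Finset.univ : Finset (Fin (m + 1))) = insert 0 (Finset.univ.erase 0) := by
    rw [Finset.insert_erase (Finset.mem_univ _)]
  have hcard : ((Finset.univ : Finset (Fin (m + 1))).erase 0).card = m := by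
    rw [Finset.card_erase_of_mem (Finset.mem_univ _)]; simp
  conv_lhs => rw [hu]
  rw [Finset.sum_powerset_insert (Finset.notMem_erase _ _)]
  congr 1
  · have := Finset.sum_powerset_apply_card
      (fun k => if k + 2 ≤ l then pN k * (s - k - 1) ^ (m - k) else 0)
      (x := (Finset.univ : Finset (Fin (m + 1))).erase 0)
    rw [hcard] at this
    simp only [smul_eq_mul] at this
    rw [← this]
    refine Finset.sum_congr rfl fun T hT => ?_
    rw [cnt_not_mem m s l h2 T]
    intro h0
    exact Finset.notMem_erase _ _ (Finset.mem_powerset.1 hT h0)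
  · have := Finset.sum_powerset_apply_card
      (fun k => if k = m then pLeL (m + 1) s l else
        pL (k + 1) l * (s - (k + 1) - 1) ^ (m - k))
      (x := (Finset.univ : Finset (Fin (m + 1))).erase 0)
    rw [hcard, Finset.sum_range_succ] at this
    simp only [smul_eq_mul, Nat.choose_self, one_mul, if_true] at this
    have e : ∑ k ∈ Finset.range m, m.choose k * (pL (k + 1) l * (s - (k + 1) - 1) ^ (m - k)) =
      ∑ k ∈ Finset.range m, m.choose k * (if k = m then pLeL (m + 1) s l else
        pL (k + 1) l * (s - (k + 1) - 1) ^ (m - k)) := by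
      refine Finset.sum_congr rfl fun k hk => ?_
      rw [if_neg (Finset.mem_range.1 hk).ne]
    rw [e, ← this]
    refine Finset.sum_congr rfl fun T hT => ?_
    have h0 : 0 ∉ T := fun h0 => Finset.notMem_erase _ _ (Finset.mem_powerset.1 hT h0)
    have hc : (insert 0 T).card = T.card + 1 := Finset.card_insert_of_notMem h0
    split_ifs with hm
    · have : insert 0 T = Finset.univ := by
        rw [← Finset.card_eq_iff_eq_univ, hc, hm]; simp
      rw [this, cnt_univ]
    · rw [cnt_mem m s l _ (Finset.mem_insert_self _ _), hc]
      · congr 2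
        omega
      · intro hu
        rw [hu] at hc
        simp at hc
        omega

/-- `p_{n;≤s}^l = s^{n-1} - Σ_{i=0}^{l-2} C(n-1,i) p_i (s-i-1)^{n-i-1}
- Σ_{i=l}^{s-2} C(n-1,i-1) p_i^l (s-i-1)^{n-i}`. -/
theorem stmt8 (l s n : ℕ) (h1 : 1 ≤ l) (h2 : l ≤ s) (h3 : s ≤ n) :
    (pLeL n s l : ℤ) =
      (s : ℤ) ^ (n - 1) -
        (∑ i ∈ Finset.range (l - 1),
          ((n - 1).choose i : ℤ) * (pN i : ℤ) * ((s : ℤ) - i - 1) ^ (n - i - 1)) -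
        ∑ i ∈ Finset.Icc l (s - 2),
          ((n - 1).choose (i - 1) : ℤ) * (pL i l : ℤ) * ((s : ℤ) - i - 1) ^ (n - i) := by
  obtain ⟨m, rfl⟩ : ∃ m, n = m + 1 := ⟨n - 1, by omega⟩
  have hkey := congrArg (Nat.cast : ℕ → ℤ) (key m s l h1 h2)
  push_cast at hkey
  have e1 : (∑ i ∈ Finset.range (l - 1),
          ((m + 1 - 1).choose i : ℤ) * (pN i : ℤ) * ((s : ℤ) - i - 1) ^ (m + 1 - i - 1)) =
      ∑ k ∈ Finset.range (m + 1), (m.choose k : ℤ) *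
        (if k + 2 ≤ l then (pN k : ℤ) * ((s - k - 1 : ℕ) : ℤ) ^ (m - k) else 0) := by
    rw [← Finset.sum_subset (s₁ := Finset.range (l - 1)) (s₂ := Finset.range (m + 1))]
    · refine Finset.sum_congr rfl fun k hk => ?_
      rw [Finset.mem_range] at hk
      rw [if_pos (by omega), mul_assoc]
      have hc : ((s - k - 1 : ℕ) : ℤ) = (s : ℤ) - k - 1 := by omega
      have hm : m + 1 - k - 1 = m - k := by omega
      rw [hc, hm, Nat.add_sub_cancel]
    · intro k hk
      rw [Finset.mem_range] at hk ⊢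
      omega
    · intro k _ hk
      rw [Finset.mem_range] at hk
      rw [if_neg (by omega), mul_zero]
  have e2 : (∑ i ∈ Finset.Icc l (s - 2),
          ((m + 1 - 1).choose (i - 1) : ℤ) * (pL i l : ℤ) * ((s : ℤ) - i - 1) ^ (m + 1 - i)) =
      ∑ k ∈ Finset.range m, (m.choose k : ℤ) *
        ((pL (k + 1) l : ℤ) * ((s - (k + 1) - 1 : ℕ) : ℤ) ^ (m - k)) := by
    have e3 := Finset.sum_Ico_add' (fun i => (m.choose (i - 1) : ℤ) *
        ((pL i l : ℤ) * ((s - i - 1 : ℕ) : ℤ) ^ (m + 1 - i))) 0 m 1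
    simp only [Nat.add_sub_cancel, Nat.add_sub_add_right] at e3
    rw [Finset.range_eq_Ico, e3]
    rw [← Finset.sum_subset (s₁ := Finset.Icc l (s - 2)) (s₂ := Finset.Ico (0 + 1) (m + 1))]
    · refine Finset.sum_congr rfl fun k hk => ?_
      rw [Finset.mem_Icc] at hk
      have hc : ((s - k - 1 : ℕ) : ℤ) = (s : ℤ) - k - 1 := by omega
      rw [hc, Nat.add_sub_cancel, mul_assoc]
    · intro k hk
      rw [Finset.mem_Icc] at hk
      rw [Finset.mem_Ico]
      omega
    · intro k hk hk'
      rw [Finset.mem_Ico] at hk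
      rw [Finset.mem_Icc] at hk'
      by_cases hl : k < l
      · rw [pL_eq_zero k l hl]; simp
      · have hz : s - k - 1 = 0 := by omega
        rw [hz, Nat.cast_zero, zero_pow (by omega)]; simp
  rw [e1, e2]
  simp only [Nat.add_sub_cancel]
  linarith
end

section
/- For every integer n ≥ 1, p_{n;≤n}^n = p_{n−1}; and for all integers s and n with 1 ≤ s ≤ n−1, p_{n;≤s}^s = p_{n−1;≤s}. -/
theorem isParkingFunction_iff_count (n : ℕ) (a : Fin n → ℕ) :
    IsParkingFunction n a ↔
      (∀ i, 1 ≤ a i) ∧ ∀ k ≤ n, k ≤ (Finset.univ.filter fun i => a i ≤ k).card := by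
  unfold IsParkingFunction
  refine and_congr_right fun _ => ⟨?_, ?_⟩
  · rintro ⟨σ, -, hσ⟩ k hk
    have h : (Finset.univ : Finset (Fin k)).card ≤
        (Finset.univ.filter fun i => a i ≤ k).card := by
      refine Finset.card_le_card_of_injOn (fun j => σ (Fin.castLE hk j)) ?_ ?_
      · intro j _
        have h1 := hσ (Fin.castLE hk j)
        have h2 := j.2
        simp only [Fin.val_castLE] at h1
        simp only [Finset.coe_filter, Finset.mem_univ, true_and, Set.mem_setOf_eq]
        omega
      · intro x _ y _ hxy
        exact Fin.castLE_injective hk (σ.injective hxy)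
    simpa using h
  · intro h
    refine ⟨Tuple.sort a, Tuple.monotone_sort a, fun i => ?_⟩
    by_contra hc
    have h1 := h (i + 1) i.2
    have h2 : (Finset.univ.filter fun j => a j ≤ (i : ℕ) + 1).card ≤ (Finset.Iio i).card := by
      refine Finset.card_le_card_of_injOn (fun j => (Tuple.sort a).symm j) ?_ ?_
      · intro j hj
        simp only [Finset.coe_filter, Finset.mem_univ, true_and, Set.mem_setOf_eq] at hj
        simp only [Finset.coe_Iio, Set.mem_Iio]
        by_contra hle
        have h3 := Tuple.monotone_sort a (not_lt.mp hle)
        simp only [Function.comp_apply, Equiv.apply_symm_apply] at h3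
        omega
      · intro x _ y _ hxy
        exact (Tuple.sort a).symm.injective hxy
    rw [Fin.card_Iio] at h2
    omega

theorem cons_parking_iff (m s : ℕ) (hs : 1 ≤ s) (hsm : s ≤ m + 1) (b : Fin m → ℕ)
    (hb : ∀ i, b i ≤ s) :
    IsParkingFunction (m + 1) (Fin.cons s b : Fin (m + 1) → ℕ) ↔ IsParkingFunction m b := by
  rw [isParkingFunction_iff_count, isParkingFunction_iff_count]
  have hcount : ∀ k, (Finset.univ.filter fun i => (Fin.cons s b : Fin (m + 1) → ℕ) i ≤ k).card
      = (if s ≤ k then 1 else 0) + (Finset.univ.filter fun i => b i ≤ k).card := by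
    intro k
    simp only [Finset.card_filter, Fin.sum_univ_succ, Fin.cons_zero, Fin.cons_succ]
  have hfull : ∀ k, s ≤ k → (Finset.univ.filter fun i => b i ≤ k).card = m := by
    intro k hk
    rw [Finset.filter_true_of_mem (fun i _ => (hb i).trans hk)]
    simp
  simp only [hcount, Fin.forall_fin_succ, Fin.cons_zero, Fin.cons_succ, hs, true_and]
  refine and_congr_right fun _ => ⟨fun h k hk => ?_, fun h k hk => ?_⟩
  · by_cases hsk : s ≤ k
    · rw [hfull k hsk]; exact hk
    · simpa [hsk] using h k (by omega)
  · by_cases hsk : s ≤ k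
    · rw [hfull k hsk]; simp only [hsk, if_true]; omega
    · simpa [hsk] using h k (by omega)

theorem pLeL_succ_eq (m s : ℕ) (hs : 1 ≤ s) (hsm : s ≤ m + 1) :
    pLeL (m + 1) s s = pLe m s := by
  unfold pLeL pLe
  symm
  refine Nat.card_congr
    { toFun := fun b => ⟨Fin.cons s b.1, (cons_parking_iff m s hs hsm b.1 b.2.2).2 b.2.1, ?_, ?_⟩
      invFun := fun a => ⟨Fin.tail a.1, ?_, fun i => a.2.2.1 i.succ⟩
      left_inv := ?_
      right_inv := ?_ }
  · intro i
    refine Fin.cases ?_ (fun j => ?_) i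
    · simp
    · simpa using b.2.2 j
  · simp [List.ofFn_succ]
  · obtain ⟨a, h1, h2, h3⟩ := a
    have h0 : a 0 = s := by simpa [List.ofFn_succ] using h3
    refine (cons_parking_iff m s hs hsm (Fin.tail a) (fun i => h2 i.succ)).1 ?_
    rw [← h0, Fin.cons_self_tail]
    exact h1
  · rintro ⟨b, hb⟩
    simp
  · rintro ⟨a, h1, h2, h3⟩
    have h0 : a 0 = s := by simpa [List.ofFn_succ] using h3
    apply Subtype.ext
    simp only
    rw [← h0, Fin.cons_self_tail]

theorem pLe_succ_eq_pN (m : ℕ) : pLe m (m + 1) = pN m := by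
  unfold pLe pN
  refine Nat.card_congr (Equiv.subtypeEquivRight fun a => ?_)
  refine ⟨fun h => h.1, fun h => ⟨h, fun i => ?_⟩⟩
  obtain ⟨-, σ, -, hσ⟩ := h
  have h1 := hσ (σ.symm i)
  have h2 := (σ.symm i).2
  rw [Equiv.apply_symm_apply] at h1
  omega

/-- `p_{n;≤n}^n = p_{n-1}` for `n ≥ 1`, and `p_{n;≤s}^s = p_{n-1;≤s}`
for `1 ≤ s ≤ n-1`. -/
theorem stmt9 :
    (∀ n : ℕ, 1 ≤ n → pLeL n n n = pN (n - 1)) ∧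
    (∀ n s : ℕ, 1 ≤ s → s ≤ n - 1 → pLeL n s s = pLe (n - 1) s) := by
  refine ⟨fun n hn => ?_, fun n s hs hsn => ?_⟩
  · obtain ⟨m, rfl⟩ : ∃ m, n = m + 1 := ⟨n - 1, by omega⟩
    rw [pLeL_succ_eq m (m + 1) hn le_rfl, pLe_succ_eq_pN]
    rfl
  · obtain ⟨m, rfl⟩ : ∃ m, n = m + 1 := ⟨n - 1, by omega⟩
    exact pLeL_succ_eq m s hs (by omega)
end
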